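/- Let (R,Λ,S) be a generalised Renner–Coxeter system, A a unitary associative commutative ring, q ∈ A, and V the free A-module with basis {T_r : r ∈ R}. Then there is a unique structure of unitary associative A-algebra on V with unit T₁ satisfying, for all r ∈ R: T_s·T_r = T_{sr} if s ∈ S and ℓ(sr) = ℓ(r)+1; T_s·T_r = q·T_r if s ∈ S and ℓ(sr) = ℓ(r); T_s·T_r = (q−1)T_r + q·T_{sr} if s ∈ S and ℓ(sr) = ℓ(r)−1; and T_e·T_r = q^{ℓ(r)−ℓ(er)}·T_{er} if e ∈ Λ∖{1}. -/

import Mathlib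

noncomputable section

/-- A generalised Renner–Coxeter system on a monoid `R`: a Coxeter system `(Rˣ, S)` on the unit
group (indexed by `B`, with data `cm`, `cs`), a cross-section semilattice `Λ` of idempotents,
and type maps `lam = λ`, `lamStar = λ_⋆` satisfying axioms (ECS1)–(ECS6). -/
structure GRCSystem (B : Type*) (R : Type*) [Monoid R] where
  /-- The Coxeter matrix indexing the simple reflections `S`. -/
  cm : CoxeterMatrix B
  /-- (ECS3): the unit group of `R` is a Coxeter group. -/
  cs : CoxeterSystem cm Rˣ
  /-- The cross-section lattice `Λ`. -/
  Λ : Set R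
  /-- The type map `λ`, with `W(e) = W_{λ(e)}`. -/
  lam : R → Set B
  /-- The map `λ_⋆`, with `W_⋆(e) = W_{λ_⋆(e)}`. -/
  lamStar : R → Set B
  /-- (ECS1): idempotents commute, i.e. `E(R)` is a (lower) semilattice. -/
  idem_mul_comm : ∀ e f : R, IsIdempotentElem e → IsIdempotentElem f → e * f = f * e
  /-- (ECS1): `R` is unit regular (factorisable). -/
  factor : ∀ r : R, ∃ (e : R) (g : Rˣ), IsIdempotentElem e ∧ r = e * (g : R)
  /-- (ECS2): elements of `Λ` are idempotent. -/
  lam_idem : ∀ e ∈ Λ, IsIdempotentElem e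
  /-- (ECS2): `Λ` is a sub-semilattice of `E(R)`. -/
  lam_mul_mem : ∀ e ∈ Λ, ∀ f ∈ Λ, e * f ∈ Λ
  /-- (ECS2): `Λ` is a transversal of `E(R)` for the conjugation action of the unit group. -/
  transversal : ∀ e : R, IsIdempotentElem e →
    ∃! f : R, f ∈ Λ ∧ ∃ w : Rˣ, (w : R) * f * ((w⁻¹ : Rˣ) : R) = e
  /-- (ECS4): comparable idempotents are simultaneously conjugate to a comparable pair in `Λ`. -/
  ecs4 : ∀ e₁ e₂ : R, IsIdempotentElem e₁ → IsIdempotentElem e₂ →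
    e₁ * e₂ = e₁ → e₂ * e₁ = e₁ →
    ∃ (w : Rˣ) (f₁ f₂ : R), f₁ ∈ Λ ∧ f₂ ∈ Λ ∧ f₁ * f₂ = f₁ ∧ f₂ * f₁ = f₁ ∧
      (w : R) * f₁ * ((w⁻¹ : Rˣ) : R) = e₁ ∧ (w : R) * f₂ * ((w⁻¹ : Rˣ) : R) = e₂
  /-- (ECS5): `W(e)` is the standard parabolic subgroup on `λ(e)`. -/
  mem_lam_iff : ∀ e ∈ Λ, ∀ w : Rˣ,
    ((w : R) * e = e * (w : R)) ↔ w ∈ Subgroup.closure (cs.simple '' lam e)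
  /-- (ECS5): `W_⋆(e)` is the standard parabolic subgroup on `λ_⋆(e)`. -/
  mem_lamStar_iff : ∀ e ∈ Λ, ∀ w : Rˣ,
    ((w : R) * e = e ∧ e * (w : R) = e) ↔ w ∈ Subgroup.closure (cs.simple '' lamStar e)
  /-- (ECS6): the map `e ↦ λ^⋆(e)` is order preserving. -/
  ecs6 : ∀ e ∈ Λ, ∀ f ∈ Λ, e * f = e →
    ∀ s : B, ((cs.simple s : R) * e = e * (cs.simple s : R) ∧ (cs.simple s : R) * e ≠ e) →
      ((cs.simple s : R) * f = f * (cs.simple s : R) ∧ (cs.simple s : R) * f ≠ f)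

namespace GRCSystem

variable {B R : Type*} [Monoid R] (G : GRCSystem B R)

/-- The standard parabolic subgroup `W_I` of the unit group of `R`. -/
def parab (I : Set B) : Subgroup Rˣ := Subgroup.closure (G.cs.simple '' I)

/-- The set `λ^⋆(e) = {s ∈ S : s e = e s ≠ e}`. -/
def lamCostar (e : R) : Set B :=
  {s : B | (G.cs.simple s : R) * e = e * (G.cs.simple s : R) ∧ (G.cs.simple s : R) * e ≠ e}

/-- Value in `R` of a letter of the alphabet `S ⊔ R`. -/
def letterVal : B ⊕ R → R := Sum.elim (fun s => ((G.cs.simple s : Rˣ) : R)) id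

/-- A word on the alphabet `S ∪ (Λ ∖ {1})`: every `inr` letter is a nonidentity element of `Λ`. -/
def IsWord (l : List (B ⊕ R)) : Prop := ∀ e : R, Sum.inr e ∈ l → e ∈ G.Λ ∧ e ≠ 1

/-- The length of a word: letters from `S` count 1, letters from `Λ` count 0. -/
def wordLen (l : List (B ⊕ R)) : ℕ := (l.filter Sum.isLeft).length

/-- The length `ℓ(r)`: the minimal length of a word on `S ∪ (Λ ∖ {1})` representing `r`. -/
def len (r : R) : ℕ :=
  sInf {n : ℕ | ∃ l : List (B ⊕ R), G.IsWord l ∧ (l.map G.letterVal).prod = r ∧ n = wordLen l}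

/-- `(w₁, e, w₂)` is the normal decomposition of `r`: `e ∈ Λ`, `w₁` is `(∅, λ_⋆(e))`-reduced
(minimal length in `w₁ W_{λ_⋆(e)}`), `w₂` is `(λ(e), ∅)`-reduced (minimal length in
`W_{λ(e)} w₂`), and `r = w₁ e w₂`. -/
def IsNormalDecomp (r : R) (w₁ : Rˣ) (e : R) (w₂ : Rˣ) : Prop :=
  e ∈ G.Λ ∧
  (∀ u ∈ G.parab (G.lamStar e), G.cs.length w₁ ≤ G.cs.length (w₁ * u)) ∧
  (∀ u ∈ G.parab (G.lam e), G.cs.length w₂ ≤ G.cs.length (u * w₂)) ∧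
  r = (w₁ : R) * e * (w₂ : R)

/-- `w` is `(I,J)`-reduced: `w` has minimal length in the double coset `W_I w W_J`. -/
def IsRed (I J : Set B) (w : Rˣ) : Prop :=
  ∀ u ∈ G.parab I, ∀ v ∈ G.parab J, G.cs.length w ≤ G.cs.length (u * w * v)

end GRCSystem

namespace CoxeterSystem

variable {B W : Type*} [Group W] {M : CoxeterMatrix B} (cs : CoxeterSystem M W)

theorem end_one_apply {α : Type*} (a : α) : (1 : Function.End α) a = a := rfl

theorem end_mul_apply {α : Type*} (f g : Function.End α) (a : α) : (f * g) a = f (g a) := rfl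

open Classical in
/-- The action of a simple reflection on pairs consisting of a group element and a parity: it
conjugates the element and flips the parity when the element is the reflection itself. -/
def parityStep (i : B) : Function.End (W × ZMod 2) :=
  fun p => (cs.simple i * p.1 * cs.simple i, p.2 + if p.1 = cs.simple i then 1 else 0)

open Classical in
theorem parityStep_mul_pow_apply (i j : B) (k : ℕ) (p : W × ZMod 2) :
    ((cs.parityStep i * cs.parityStep j) ^ k : Function.End (W × ZMod 2)) p =
      ((cs.simple i * cs.simple j) ^ k * p.1 * ((cs.simple i * cs.simple j) ^ k)⁻¹,
        p.2 + ∑ n ∈ Finset.range (2 * k),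
          if p.1 = ((cs.simple i * cs.simple j) ^ n)⁻¹ * cs.simple j then 1 else 0) := by
  induction k with
  | zero => simp [end_one_apply]
  | succ k ih =>
    have hflip : ∀ n : ℕ, cs.simple j * (cs.simple i * cs.simple j) ^ n =
        ((cs.simple i * cs.simple j) ^ n)⁻¹ * cs.simple j := by
      intro n
      induction n with
      | zero => simp
      | succ n ihn =>
        rw [pow_succ, ← mul_assoc, ihn, ← pow_succ, pow_succ', mul_inv_rev]
        simp [mul_assoc]
    have h1 : ∀ x : W, (cs.simple i * cs.simple j) ^ k * x *
        ((cs.simple i * cs.simple j) ^ k)⁻¹ = cs.simple j ↔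
        x = ((cs.simple i * cs.simple j) ^ (2 * k))⁻¹ * cs.simple j := by
      intro x
      rw [mul_inv_eq_iff_eq_mul, hflip, ← eq_inv_mul_iff_mul_eq, two_mul, pow_add, mul_inv_rev,
        mul_assoc]
    have h2 : ∀ x : W, cs.simple j * ((cs.simple i * cs.simple j) ^ k * x *
        ((cs.simple i * cs.simple j) ^ k)⁻¹) * cs.simple j = cs.simple i ↔
        x = ((cs.simple i * cs.simple j) ^ (2 * k + 1))⁻¹ * cs.simple j := by
      intro x
      have : ∀ y : W, cs.simple j * y * cs.simple j = cs.simple i ↔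
          y = (cs.simple i * cs.simple j)⁻¹ * cs.simple j := by
        intro y
        constructor
        · intro h
          rw [mul_inv_rev, inv_simple, inv_simple, ← h]
          simp [mul_assoc]
        · rintro rfl
          simp [mul_assoc]
      rw [this, mul_inv_eq_iff_eq_mul, mul_assoc _ (cs.simple j), hflip, ← eq_inv_mul_iff_mul_eq,
        show 2 * k + 1 = k + (k + 1) by ring, pow_add, pow_succ']
      simp only [mul_inv_rev, mul_assoc]
    rw [pow_succ', end_mul_apply, end_mul_apply, ih]
    simp only [parityStep, h1, h2]
    refine Prod.ext ?_ ?_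
    · simp [pow_succ', mul_assoc]
    · rw [show 2 * (k + 1) = 2 * k + 1 + 1 by ring, Finset.sum_range_succ, Finset.sum_range_succ]
      simp only [add_assoc]

theorem isLiftable_parityStep : M.IsLiftable cs.parityStep := by
  classical
  intro i j
  funext p
  rw [parityStep_mul_pow_apply, cs.simple_mul_simple_pow, two_mul, Finset.sum_range_add]
  simp only [pow_add, cs.simple_mul_simple_pow, one_mul, mul_one, inv_one, CharTwo.add_self_eq_zero,
    add_zero]
  rfl

/-- The action of the group on pairs consisting of a group element and a parity. -/
def parityHom : W →* Function.End (W × ZMod 2) :=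
  cs.lift ⟨cs.parityStep, cs.isLiftable_parityStep⟩

theorem parityHom_simple (i : B) : cs.parityHom (cs.simple i) = cs.parityStep i :=
  cs.lift_apply_simple cs.isLiftable_parityStep i

open Classical in
theorem parityHom_wordProd_apply (ω : List B) (x : W) :
    cs.parityHom (cs.wordProd ω) (x, 0) =
      (cs.wordProd ω * x * (cs.wordProd ω)⁻¹, ((cs.rightInvSeq ω).count x : ZMod 2)) := by
  induction ω with
  | nil => simp [end_one_apply]
  | cons i ω ih =>
    rw [wordProd_cons, map_mul, end_mul_apply, ih, parityHom_simple]
    refine Prod.ext ?_ ?_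
    · simp [parityStep, mul_assoc]
    · have : ∀ y z : W, z * x * z⁻¹ = y ↔ z⁻¹ * y * z = x := by
        intro y z
        constructor
        · rintro rfl; group
        · rintro rfl; group
      simp [parityStep, rightInvSeq, List.count_cons, this]

theorem parityHom_simple_of_isRightDescent {w : W} {i : B} (h : cs.IsRightDescent w i) :
    (cs.parityHom w (cs.simple i, 0)).2 = 1 := by
  classical
  obtain ⟨ω, hω, hw⟩ := cs.exists_isReduced (w * cs.simple i)
  have hw' : w = cs.wordProd (ω.concat i) := by
    rw [wordProd_concat, ← hw, mul_assoc, simple_mul_simple_self, mul_one]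
  have hred : cs.IsReduced (ω.concat i) := by
    have h1 := cs.isRightDescent_iff.mp h
    have h2 := hω.eq
    rw [← hw] at h2
    rw [IsReduced, ← hw', ← h1, h2]
    simp
  rw [hw', parityHom_wordProd_apply]
  simp only
  rw [List.count_eq_one_of_mem hred.nodup_rightInvSeq]
  · simp
  · rw [rightInvSeq_concat]
    simp

theorem parityHom_simple_of_not_isRightDescent {w : W} {i : B} (h : ¬ cs.IsRightDescent w i) :
    (cs.parityHom w (cs.simple i, 0)).2 = 0 := by
  classical
  obtain ⟨ω, hω, hw⟩ := cs.exists_isReduced w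
  rw [hw, parityHom_wordProd_apply]
  simp only
  rw [List.count_eq_zero_of_not_mem]
  · simp
  · intro hmem
    have := cs.isRightInversion_of_mem_rightInvSeq hω hmem
    rw [isRightInversion_simple_iff_isRightDescent, ← hw] at this
    exact h this

theorem simple_mul_eq_mul_simple_of_isRightDescent {w : W} {i j : B}
    (h : ¬ cs.IsRightDescent w i) (h' : cs.IsRightDescent (cs.simple j * w) i) :
    cs.simple j * w = w * cs.simple i := by
  classical
  have h0 := cs.parityHom_simple_of_not_isRightDescent h
  have h1 := cs.parityHom_simple_of_isRightDescent h'
  have hfst : (cs.parityHom w (cs.simple i, 0)).1 = w * cs.simple i * w⁻¹ := by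
    obtain ⟨ω, rfl⟩ := cs.wordProd_surjective w
    rw [parityHom_wordProd_apply]
  rw [map_mul, end_mul_apply, parityHom_simple] at h1
  simp only [parityStep, h0, hfst, zero_add] at h1
  split_ifs at h1 with heq
  · rw [← heq]; group
  · exact absurd h1 (by decide)

theorem simple_mul_eq_mul_simple_of_isLeftDescent {w : W} {i j : B}
    (h : ¬ cs.IsLeftDescent w i) (h' : cs.IsLeftDescent (w * cs.simple j) i) :
    cs.simple i * w = w * cs.simple j := by
  rw [← isRightDescent_inv_iff] at h h'
  rw [mul_inv_rev, inv_simple] at h'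
  have := congrArg (·⁻¹) (cs.simple_mul_eq_mul_simple_of_isRightDescent h h')
  simpa using this.symm

theorem exists_sublist_of_isLeftDescent (ω : List B) (i : B)
    (h : cs.IsLeftDescent (cs.wordProd ω) i) :
    ∃ ω' : List B, ω'.Sublist ω ∧ ω'.length < ω.length ∧
      cs.wordProd ω' = cs.simple i * cs.wordProd ω := by
  induction ω using List.reverseRecOn with
  | nil => exact absurd h (by simpa using cs.not_isLeftDescent_one i)
  | append_singleton ω j ih =>
    by_cases hd : cs.IsLeftDescent (cs.wordProd ω) i
    · obtain ⟨ω', h1, h2, h3⟩ := ih hd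
      refine ⟨ω' ++ [j], h1.append (List.Sublist.refl _), by simpa using h2, ?_⟩
      rw [wordProd_append, h3, wordProd_append, mul_assoc]
    · rw [wordProd_append, wordProd_singleton] at h
      refine ⟨ω, List.sublist_append_left _ _, by simp, ?_⟩
      rw [wordProd_append, wordProd_singleton, ← mul_assoc,
        cs.simple_mul_eq_mul_simple_of_isLeftDescent hd h, mul_assoc, simple_mul_simple_self,
        mul_one]

theorem exists_sublist_of_not_isReduced (ω : List B) (h : ¬ cs.IsReduced ω) :
    ∃ ω' : List B, ω'.Sublist ω ∧ ω'.length < ω.length ∧ cs.wordProd ω' = cs.wordProd ω := by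
  induction ω with
  | nil => exact absurd (by simp [IsReduced]) h
  | cons i ω ih =>
    by_cases hω : cs.IsReduced ω
    · have hd : cs.IsLeftDescent (cs.wordProd ω) i := by
        by_contra hd
        rw [not_isLeftDescent_iff] at hd
        apply h
        rw [IsReduced, wordProd_cons, hd, hω.eq, List.length_cons]
      obtain ⟨ω', h1, h2, h3⟩ := cs.exists_sublist_of_isLeftDescent ω i hd
      exact ⟨ω', h1.cons i, by simp; lia, by rw [h3, wordProd_cons]⟩
    · obtain ⟨ω', h1, h2, h3⟩ := ih hω
      exact ⟨i :: ω', h1.cons_cons i, by simpa using h2, by rw [wordProd_cons, h3, wordProd_cons]⟩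

theorem mem_closure_simple_iff (I : Set B) (w : W) :
    w ∈ Subgroup.closure (cs.simple '' I) ↔
      ∃ ω : List B, (∀ i ∈ ω, i ∈ I) ∧ cs.wordProd ω = w := by
  constructor
  · intro hw
    induction hw using Subgroup.closure_induction with
    | mem x hx =>
      obtain ⟨i, hi, rfl⟩ := hx
      exact ⟨[i], by simpa using hi, by simp⟩
    | one => exact ⟨[], by simp, by simp⟩
    | mul x y _ _ hx hy =>
      obtain ⟨a, ha, rfl⟩ := hx
      obtain ⟨b, hb, rfl⟩ := hy
      refine ⟨a ++ b, ?_, by rw [wordProd_append]⟩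
      intro i hi
      rcases List.mem_append.mp hi with h | h
      exacts [ha i h, hb i h]
    | inv x _ hx =>
      obtain ⟨a, ha, rfl⟩ := hx
      exact ⟨a.reverse, fun i hi => ha i (List.mem_reverse.mp hi), by simp⟩
  · rintro ⟨ω, hω, rfl⟩
    refine Subgroup.list_prod_mem _ ?_
    intro x hx
    obtain ⟨i, hi, rfl⟩ := List.mem_map.mp hx
    exact Subgroup.subset_closure ⟨i, hω i hi, rfl⟩

theorem exists_length_add_eq_of_mul_mem (I J K : Set B) {v y x : W}
    (hv : v ∈ Subgroup.closure (cs.simple '' I)) (hy : y ∈ Subgroup.closure (cs.simple '' J))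
    (hx : x ∈ Subgroup.closure (cs.simple '' K)) :
    ∃ v' ∈ Subgroup.closure (cs.simple '' I), ∃ y' ∈ Subgroup.closure (cs.simple '' J),
      ∃ x' ∈ Subgroup.closure (cs.simple '' K), v' * y' * x' = v * y * x ∧
        cs.length (v * y * x) = cs.length v' + cs.length y' + cs.length x' := by
  simp only [mem_closure_simple_iff] at hv hy hx
  obtain ⟨a, ha, rfl⟩ := hv
  obtain ⟨b, hb, rfl⟩ := hy
  obtain ⟨c, hc, rfl⟩ := hx
  induction hn : (a ++ b ++ c).length using Nat.strong_induction_on generalizing a b c with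
  | _ n ih =>
    by_cases hred : cs.IsReduced (a ++ b ++ c)
    · refine ⟨_, (cs.mem_closure_simple_iff I _).mpr ⟨a, ha, rfl⟩, _,
        (cs.mem_closure_simple_iff J _).mpr ⟨b, hb, rfl⟩, _,
        (cs.mem_closure_simple_iff K _).mpr ⟨c, hc, rfl⟩, rfl, ?_⟩
      have h := hred.eq
      simp only [wordProd_append, List.length_append] at h
      have h1 := cs.length_mul_le (cs.wordProd a * cs.wordProd b) (cs.wordProd c)
      have h2 := cs.length_mul_le (cs.wordProd a) (cs.wordProd b)
      have h3 := cs.length_wordProd_le a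
      have h4 := cs.length_wordProd_le b
      have h5 := cs.length_wordProd_le c
      lia
    · obtain ⟨ω', hs, hl, hp⟩ := cs.exists_sublist_of_not_isReduced _ hred
      obtain ⟨ab, c', rfl, hab, hc'⟩ := List.sublist_append_iff.mp hs
      obtain ⟨a', b', rfl, ha', hb'⟩ := List.sublist_append_iff.mp hab
      simp only [wordProd_append] at hp
      have := ih _ (hn ▸ hl) a' (fun i hi => ha i (ha'.subset hi)) b'
        (fun i hi => hb i (hb'.subset hi)) c' (fun i hi => hc i (hc'.subset hi)) rfl
      rwa [hp] at this

theorem length_mul_of_forall_length_le (I : Set B) {z x : W}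
    (hx : ∀ u ∈ Subgroup.closure (cs.simple '' I), cs.length x ≤ cs.length (u * x))
    (hz : z ∈ Subgroup.closure (cs.simple '' I)) :
    cs.length (z * x) = cs.length z + cs.length x := by
  obtain ⟨a, ha, hal⟩ : ∃ a : List B, ((∀ i ∈ a, i ∈ I) ∧ cs.wordProd a = z) ∧
      ∀ b : List B, (∀ i ∈ b, i ∈ I) ∧ cs.wordProd b = z → a.length ≤ b.length := by
    obtain ⟨a, ha⟩ := (cs.mem_closure_simple_iff I z).mp hz
    exact ⟨_, Function.argminOn_mem List.length {a | (∀ i ∈ a, i ∈ I) ∧ cs.wordProd a = z} ⟨a, ha⟩,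
      fun b hb => Function.argminOn_le List.length _ hb⟩
  obtain ⟨ξ, hξ, rfl⟩ := cs.exists_isReduced x
  have hred : cs.IsReduced (a ++ ξ) := by
    by_contra hred
    obtain ⟨ω', hs, hl, hp⟩ := cs.exists_sublist_of_not_isReduced _ hred
    obtain ⟨a', ξ', rfl, ha', hξ'⟩ := List.sublist_append_iff.mp hs
    have haI : ∀ i ∈ a', i ∈ I := fun i hi => ha.1 i (ha'.subset hi)
    simp only [wordProd_append] at hp
    have h1 := hx ((cs.wordProd a')⁻¹ * cs.wordProd a) (mul_mem
      (inv_mem ((cs.mem_closure_simple_iff I _).mpr ⟨a', haI, rfl⟩))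
      ((cs.mem_closure_simple_iff I _).mpr ⟨a, ha.1, rfl⟩))
    rw [mul_assoc, ← hp, inv_mul_cancel_left, hξ.eq] at h1
    have h2 := hξ'.eq_of_length_le (h1.trans (cs.length_wordProd_le _))
    subst h2
    have h3 := hal a' ⟨haI, by rw [← ha.2]; exact mul_right_cancel hp⟩
    simp only [List.length_append] at hl
    lia
  have h := hred.eq
  rw [wordProd_append, ha.2, List.length_append] at h
  have h1 := cs.length_mul_le z (cs.wordProd ξ)
  have h2 := cs.length_wordProd_le a
  rw [ha.2] at h2
  rw [hξ.eq] at h1 ⊢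
  lia

theorem length_mul_of_forall_length_le_right (I : Set B) {z x : W}
    (hx : ∀ u ∈ Subgroup.closure (cs.simple '' I), cs.length x ≤ cs.length (x * u))
    (hz : z ∈ Subgroup.closure (cs.simple '' I)) :
    cs.length (x * z) = cs.length x + cs.length z := by
  have h := cs.length_mul_of_forall_length_le I (x := x⁻¹) (z := z⁻¹) (fun u hu => by
    rw [cs.length_inv, ← cs.length_inv (u * x⁻¹), mul_inv_rev, inv_inv]
    exact hx _ (inv_mem hu)) (inv_mem hz)
  rw [← mul_inv_rev, cs.length_inv, cs.length_inv, cs.length_inv] at h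
  rw [h, add_comm]

theorem exists_forall_length_le_mul_left (H : Subgroup W) (w : W) :
    ∃ z ∈ H, ∃ x : W, w = z * x ∧ ∀ u ∈ H, cs.length x ≤ cs.length (u * x) := by
  have hne : {x : W | w * x⁻¹ ∈ H}.Nonempty := ⟨w, by simp⟩
  set x := Function.argminOn cs.length {x : W | w * x⁻¹ ∈ H} hne
  have hx : w * x⁻¹ ∈ H := Function.argminOn_mem cs.length _ hne
  refine ⟨_, hx, x, by group, fun u hu => Function.argminOn_le cs.length _ ?_⟩
  have := mul_mem hx (inv_mem hu)
  simpa [mul_assoc] using this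

theorem exists_forall_length_le_mul_right (H : Subgroup W) (w : W) :
    ∃ z ∈ H, ∃ x : W, w = x * z ∧ ∀ u ∈ H, cs.length x ≤ cs.length (x * u) := by
  obtain ⟨z, hz, x, hx, h⟩ := cs.exists_forall_length_le_mul_left H w⁻¹
  refine ⟨z⁻¹, inv_mem hz, x⁻¹, by rw [← mul_inv_rev, ← hx, inv_inv], fun u hu => ?_⟩
  rw [cs.length_inv, ← cs.length_inv (x⁻¹ * u), mul_inv_rev, inv_inv]
  exact h _ (inv_mem hu)

theorem simple_mul_mem_or_isLeftDescent_iff (I : Set B) (w : W) (i : B) :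
    (∃ u ∈ Subgroup.closure (cs.simple '' I), cs.simple i * w = w * u) ∨
      ∀ u ∈ Subgroup.closure (cs.simple '' I),
        (cs.IsLeftDescent (w * u) i ↔ cs.IsLeftDescent w i) := by
  by_cases hfix : ∃ u ∈ Subgroup.closure (cs.simple '' I), cs.simple i * w = w * u
  · exact Or.inl hfix
  refine Or.inr fun u hu => ?_
  obtain ⟨ω, hω, rfl⟩ := (cs.mem_closure_simple_iff I u).mp hu
  clear hu
  induction ω using List.reverseRecOn with
  | nil => simp
  | append_singleton ω j ih =>
    have hωI : ∀ i ∈ ω, i ∈ I := fun i hi => hω i (by simp [hi])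
    have hu := (cs.mem_closure_simple_iff I _).mpr ⟨ω, hωI, rfl⟩
    have hj : cs.simple j ∈ Subgroup.closure (cs.simple '' I) :=
      Subgroup.subset_closure ⟨j, hω j (by simp), rfl⟩
    rw [← ih hωI, wordProd_append, wordProd_singleton, ← mul_assoc]
    have hmem := mul_mem (mul_mem hu hj) (inv_mem hu)
    by_contra hne
    apply hfix
    refine ⟨_, hmem, ?_⟩
    suffices cs.simple i * (w * cs.wordProd ω) = w * cs.wordProd ω * cs.simple j by
      rw [← mul_assoc, ← mul_assoc, ← this]
      group
    by_cases hd : cs.IsLeftDescent (w * cs.wordProd ω) i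
    · have hd' : ¬ cs.IsLeftDescent (w * cs.wordProd ω * cs.simple j) i := by tauto
      have := cs.simple_mul_eq_mul_simple_of_isLeftDescent (j := j) hd' (by simpa using hd)
      rw [simple_mul_simple_cancel_right] at this
      rw [← this, simple_mul_simple_cancel_left, this]
    · exact cs.simple_mul_eq_mul_simple_of_isLeftDescent hd (by tauto)

theorem exists_mul_or_forall_length_le_mul_simple_left (I : Set B) {w : W} (i : B)
    (hw : ∀ u ∈ Subgroup.closure (cs.simple '' I), cs.length w ≤ cs.length (w * u)) :
    (∃ u ∈ Subgroup.closure (cs.simple '' I), cs.simple i * w = w * u) ∨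
      (∀ u ∈ Subgroup.closure (cs.simple '' I),
        (cs.IsLeftDescent (w * u) i ↔ cs.IsLeftDescent w i)) ∧
      ∀ u ∈ Subgroup.closure (cs.simple '' I),
        cs.length (cs.simple i * w) ≤ cs.length (cs.simple i * w * u) := by
  refine (cs.simple_mul_mem_or_isLeftDescent_iff I w i).imp_right fun h => ⟨h, fun u hu => ?_⟩
  have h1 := h u hu
  have h2 := hw u hu
  rw [mul_assoc]
  by_cases hd : cs.IsLeftDescent w i
  · have h3 := cs.isLeftDescent_iff.mp hd
    have h4 := cs.isLeftDescent_iff.mp (h1.mpr hd)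
    lia
  · have h3 := cs.not_isLeftDescent_iff.mp hd
    have h4 := cs.not_isLeftDescent_iff.mp (mt h1.mp hd)
    lia

theorem exists_mul_or_forall_length_le_mul_simple_right (I : Set B) {w : W} (i : B)
    (hw : ∀ u ∈ Subgroup.closure (cs.simple '' I), cs.length w ≤ cs.length (u * w)) :
    (∃ u ∈ Subgroup.closure (cs.simple '' I), w * cs.simple i = u * w) ∨
      ∀ u ∈ Subgroup.closure (cs.simple '' I),
        cs.length (w * cs.simple i) ≤ cs.length (u * (w * cs.simple i)) := by
  have hw' : ∀ u ∈ Subgroup.closure (cs.simple '' I), cs.length w⁻¹ ≤ cs.length (w⁻¹ * u) := by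
    intro u hu
    rw [cs.length_inv, ← cs.length_inv (w⁻¹ * u), mul_inv_rev, inv_inv]
    exact hw _ (inv_mem hu)
  rcases cs.exists_mul_or_forall_length_le_mul_simple_left I i hw' with ⟨u, hu, h⟩ | ⟨_, h⟩
  · refine Or.inl ⟨u⁻¹, inv_mem hu, ?_⟩
    have := congrArg (·⁻¹) h
    simpa using this
  · refine Or.inr fun u hu => ?_
    have := h _ (inv_mem hu)
    rw [← cs.length_inv, ← cs.length_inv (_ * u⁻¹)] at this
    simpa using this

end CoxeterSystem

namespace GRCSystem

variable {B R : Type*} [Monoid R] (G : GRCSystem B R)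

theorem mul_eq_self_iff (G : GRCSystem B R) {e : R} (he : IsIdempotentElem e) (u : Rˣ) :
    (u : R) * e = e ↔ e * (u : R) = e := by
  constructor
  · intro h
    have h' : ((u⁻¹ : Rˣ) : R) * e = e := by rw [Units.inv_mul_eq_iff_eq_mul, h]
    have hid : IsIdempotentElem (e * ((u⁻¹ : Rˣ) : R)) := by
      rw [IsIdempotentElem, mul_assoc, ← mul_assoc _ e, h', ← mul_assoc, he.eq]
    have hc := G.idem_mul_comm e _ he hid
    rw [mul_assoc, h', ← mul_assoc, he.eq, Units.mul_inv_eq_iff_eq_mul] at hc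
    exact hc.symm
  · intro h
    have h' : e * ((u⁻¹ : Rˣ) : R) = e := by rw [Units.mul_inv_eq_iff_eq_mul, h]
    have hid : IsIdempotentElem (((u⁻¹ : Rˣ) : R) * e) := by
      rw [IsIdempotentElem, mul_assoc, ← mul_assoc e, h', he.eq]
    have hc := G.idem_mul_comm e _ he hid
    rw [mul_assoc _ e e, ← mul_assoc, h', he.eq, eq_comm, Units.inv_mul_eq_iff_eq_mul] at hc
    exact hc.symm

theorem mem_parab_lam {e : R} (he : e ∈ G.Λ) (w : Rˣ) :
    w ∈ G.parab (G.lam e) ↔ (w : R) * e = e * (w : R) :=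
  (G.mem_lam_iff e he w).symm

theorem mem_parab_lamStar {e : R} (he : e ∈ G.Λ) (w : Rˣ) :
    w ∈ G.parab (G.lamStar e) ↔ (w : R) * e = e := by
  refine (G.mem_lamStar_iff e he w).symm.trans ⟨fun h => h.1, fun h => ⟨h, ?_⟩⟩
  rwa [← G.mul_eq_self_iff (G.lam_idem e he)]

theorem isIdempotentElem_conj {e : R} (he : IsIdempotentElem e) (w : Rˣ) :
    IsIdempotentElem ((w : R) * e * ((w⁻¹ : Rˣ) : R)) := by
  rw [IsIdempotentElem]
  simp only [mul_assoc, Units.inv_mul_cancel_left]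
  rw [← mul_assoc e e, he.eq]

theorem eq_of_conj_eq {e f : R} (he : e ∈ G.Λ) (hf : f ∈ G.Λ) {a b : Rˣ}
    (h : (a : R) * e * ((a⁻¹ : Rˣ) : R) = (b : R) * f * ((b⁻¹ : Rˣ) : R)) : e = f :=
  (G.transversal _ (isIdempotentElem_conj (G.lam_idem e he) a)).unique ⟨he, a, rfl⟩
    ⟨hf, b, h.symm⟩

theorem one_mem_Λ : (1 : R) ∈ G.Λ := by
  obtain ⟨f, ⟨hf, w, hw⟩, -⟩ := G.transversal 1 IsIdempotentElem.one
  rw [Units.mul_inv_eq_iff_eq_mul, one_mul] at hw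
  have hf1 : f = 1 := by simpa using congrArg (fun z => ((w⁻¹ : Rˣ) : R) * z) hw
  exact hf1 ▸ hf

theorem conj_eq_conj_of_mul_eq {k : R} (hk : k ∈ G.Λ) {a b : Rˣ}
    (h : ((a : R) * k * ((a⁻¹ : Rˣ) : R)) * ((b : R) * k * ((b⁻¹ : Rˣ) : R)) =
      (a : R) * k * ((a⁻¹ : Rˣ) : R)) :
    (a : R) * k * ((a⁻¹ : Rˣ) : R) = (b : R) * k * ((b⁻¹ : Rˣ) : R) := by
  have ha := isIdempotentElem_conj (G.lam_idem k hk) a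
  have hb := isIdempotentElem_conj (G.lam_idem k hk) b
  obtain ⟨w, f₁, f₂, hf₁, hf₂, -, -, h₁, h₂⟩ :=
    G.ecs4 _ _ ha hb h ((G.idem_mul_comm _ _ hb ha).trans h)
  rw [← h₁, ← h₂, G.eq_of_conj_eq hf₁ hk h₁, G.eq_of_conj_eq hf₂ hk h₂]

theorem inv_mul_mem_parab_lam {e : R} (he : e ∈ G.Λ) {a b : Rˣ}
    (h : (b : R) * e * ((b⁻¹ : Rˣ) : R) = (a : R) * e * ((a⁻¹ : Rˣ) : R)) :
    a⁻¹ * b ∈ G.parab (G.lam e) := by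
  rw [G.mem_parab_lam he]
  push_cast
  rw [mul_assoc, (Units.mul_inv_eq_iff_eq_mul _).mp h]
  simp [mul_assoc]

theorem exists_mul_of_mem_parab_lam {g : R} (hg : g ∈ G.Λ) {z : Rˣ}
    (hz : z ∈ G.parab (G.lam g)) :
    ∃ c ∈ G.parab (G.lamCostar g), ∃ d ∈ G.parab (G.lamStar g), z = c * d := by
  obtain ⟨ω, hω, rfl⟩ := (G.cs.mem_closure_simple_iff _ _).mp hz
  clear hz
  induction ω using List.reverseRecOn with
  | nil => exact ⟨1, one_mem _, 1, one_mem _, by simp⟩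
  | append_singleton ω j ih =>
    obtain ⟨c, hc, d, hd, h⟩ := ih fun i hi => hω i (by simp [hi])
    have hj : G.cs.simple j ∈ G.parab (G.lam g) := Subgroup.subset_closure ⟨j, hω j (by simp), rfl⟩
    rw [G.mem_parab_lam hg] at hj
    rw [CoxeterSystem.wordProd_append, CoxeterSystem.wordProd_singleton, h]
    by_cases hs : (G.cs.simple j : R) * g = g
    · exact ⟨c, hc, d * G.cs.simple j, mul_mem hd ((G.mem_parab_lamStar hg _).mpr hs),
        mul_assoc _ _ _⟩
    · refine ⟨c * G.cs.simple j, mul_mem hc (Subgroup.subset_closure ⟨j, ⟨hj, hs⟩, rfl⟩),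
        G.cs.simple j * d * G.cs.simple j, ?_, ?_⟩
      · rw [G.mem_parab_lamStar hg] at hd ⊢
        push_cast
        rw [mul_assoc, hj, ← mul_assoc, mul_assoc _ _ g, hd, hj, mul_assoc, ← Units.val_mul,
          CoxeterSystem.simple_mul_simple_self, Units.val_one, mul_one]
      · simp [mul_assoc]

theorem exists_mul_of_mem_parab_lam_of_forall_length {g : R} (hg : g ∈ G.Λ) {z : Rˣ}
    (hz : z ∈ G.parab (G.lam g)) :
    ∃ c ∈ G.parab (G.lamCostar g), ∃ d ∈ G.parab (G.lamStar g), z = c * d ∧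
      ∀ u ∈ G.parab (G.lamStar g), G.cs.length (c * u) = G.cs.length c + G.cs.length u := by
  obtain ⟨d, hd, c, rfl, hc⟩ := G.cs.exists_forall_length_le_mul_right (G.parab (G.lamStar g)) z
  have hle : G.parab (G.lamStar g) ≤ G.parab (G.lam g) := by
    intro u hu
    rw [G.mem_parab_lamStar hg] at hu
    rw [G.mem_parab_lam hg, hu, (G.mul_eq_self_iff (G.lam_idem g hg) u).mp hu]
  have hcl : c ∈ G.parab (G.lam g) := by
    simpa using mul_mem hz (inv_mem (hle hd))
  obtain ⟨c₀, hc₀, d₀, hd₀, h₀⟩ := G.exists_mul_of_mem_parab_lam hg hcl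
  obtain ⟨c₁, hc₁, o, ho, d₁, hd₁, hcd, hlen⟩ := G.cs.exists_length_add_eq_of_mul_mem _
    (∅ : Set B) _ hc₀ (one_mem _) hd₀
  obtain rfl : o = 1 := by simpa using ho
  simp only [mul_one, CoxeterSystem.length_one, add_zero, ← h₀] at hcd hlen
  have h₁ := hc _ (inv_mem hd₁)
  rw [← hcd, mul_inv_cancel_right, hcd] at h₁
  obtain rfl : d₁ = 1 := G.cs.length_eq_zero_iff.mp (by lia)
  rw [mul_one] at hcd
  exact ⟨c, hcd ▸ hc₁, d, hd, rfl, fun u hu => G.cs.length_mul_of_forall_length_le_right _ hc hu⟩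

theorem parab_lamCostar_le {g f : R} (hg : g ∈ G.Λ) (hf : f ∈ G.Λ) (h : g * f = g) :
    G.parab (G.lamCostar g) ≤ G.parab (G.lam f) := by
  refine (Subgroup.closure_le _).mpr ?_
  rintro _ ⟨s, hs, rfl⟩
  exact (G.mem_parab_lam hf _).mpr (G.ecs6 g hg f hf h s hs).1

theorem exists_mul_mul_eq_of_mem {e f : R} (he : e ∈ G.Λ) (hf : f ∈ G.Λ) (w : Rˣ) :
    ∃ g ∈ G.Λ, g * e = g ∧ g * f = g ∧ ∃ v ∈ G.parab (G.lam e), ∃ y ∈ G.parab (G.lamStar g),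
      ∃ x ∈ G.parab (G.lam f), w = v * y * x ∧
        G.cs.length w = G.cs.length v + G.cs.length y + G.cs.length x ∧
        e * (w : R) * f = (v : R) * g * (x : R) := by
  have hei := G.lam_idem e he
  have hfi := G.lam_idem f hf
  set p : R := (w : R) * f * ((w⁻¹ : Rˣ) : R) with hp
  have hpi : IsIdempotentElem p := isIdempotentElem_conj hfi w
  have hcomm : e * p = p * e := G.idem_mul_comm e p hei hpi
  have hhi : IsIdempotentElem (e * p) := by
    rw [IsIdempotentElem, mul_assoc, ← mul_assoc p, ← hcomm, mul_assoc e, hpi.eq, ← mul_assoc,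
      hei.eq]
  have h1 : e * p * e = e * p := by rw [mul_assoc, ← hcomm, ← mul_assoc, hei.eq]
  have h2 : e * (e * p) = e * p := by rw [← mul_assoc, hei.eq]
  have h3 : e * p * p = e * p := by rw [mul_assoc, hpi.eq]
  have h4 : p * (e * p) = e * p := by rw [hcomm, ← mul_assoc, hpi.eq]
  obtain ⟨v, g, e', hg, he', hge, -, hvg, hve⟩ := G.ecs4 _ _ hhi hei h1 h2
  obtain ⟨v', g', f', hg', hf', hgf, -, hvg', hvf⟩ := G.ecs4 _ _ hhi hpi h3 h4
  obtain rfl : e' = e := G.eq_of_conj_eq (a := v) (b := 1) he' he (by simpa using hve)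
  obtain rfl : f' = f := G.eq_of_conj_eq (a := v') (b := w) hf' hf (by rw [hvf, hp])
  obtain rfl : g' = g := G.eq_of_conj_eq (a := v') (b := v) hg' hg (by rw [hvg, hvg'])
  have hv : v ∈ G.parab (G.lam e') := by
    rw [G.mem_parab_lam he]
    exact (Units.mul_inv_eq_iff_eq_mul v).mp hve
  have hx : v'⁻¹ * w ∈ G.parab (G.lam f') := G.inv_mul_mem_parab_lam hf hvf.symm
  have hy : v⁻¹ * v' ∈ G.parab (G.lam g') := G.inv_mul_mem_parab_lam hg (hvg'.trans hvg.symm)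
  obtain ⟨c, hc, d, hd, hcd⟩ := G.exists_mul_of_mem_parab_lam hg hy
  have hw : w = v * c * d * (v'⁻¹ * w) := by
    rw [mul_assoc v, ← hcd]; group
  obtain ⟨v₁, hv₁, y, hy₁, x, hx₁, hprod, hlen⟩ := G.cs.exists_length_add_eq_of_mul_mem _ _ _
    (mul_mem hv (G.parab_lamCostar_le hg he hge hc)) hd hx
  rw [← hw] at hprod hlen
  refine ⟨g', hg, hge, hgf, v₁, hv₁, y, hy₁, x, hx₁, hprod.symm, hlen, ?_⟩
  have hv₂ := (G.mem_parab_lam he _).mp hv₁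
  have hx₂ := (G.mem_parab_lam hf _).mp hx₁
  have hy₂ := (G.mem_parab_lamStar hg _).mp hy₁
  have hy₃ := (G.mul_eq_self_iff (G.lam_idem g' hg) y).mp hy₂
  have hy₄ : g' * ((y⁻¹ : Rˣ) : R) = g' := by rw [Units.mul_inv_eq_iff_eq_mul, hy₃]
  have hxf : (x : R) * f' * ((x⁻¹ : Rˣ) : R) = f' := by rw [Units.mul_inv_eq_iff_eq_mul, hx₂]
  have hconj : e' * p = (v₁ : R) * (e' * ((y : R) * f' * ((y⁻¹ : Rˣ) : R))) *
      ((v₁⁻¹ : Rˣ) : R) := by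
    rw [← mul_assoc (v₁ : R), hv₂, hp, ← hprod]
    nth_rw 2 [← hxf]
    simp [mul_assoc]
  have heyf : e' * ((y : R) * f' * ((y⁻¹ : Rˣ) : R)) =
      ((v₁⁻¹ * v : Rˣ) : R) * g' * (((v₁⁻¹ * v)⁻¹ : Rˣ) : R) := by
    rw [← hvg] at hconj
    have := congrArg (fun z => ((v₁⁻¹ : Rˣ) : R) * z * (v₁ : R)) hconj
    simp only [mul_assoc, Units.inv_mul_cancel_left, Units.inv_mul, mul_one] at this
    simp only [mul_assoc, mul_inv_rev, inv_inv, Units.val_mul, this]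
  have hle : g' * (e' * ((y : R) * f' * ((y⁻¹ : Rˣ) : R))) = g' := by
    rw [← mul_assoc, hge, ← mul_assoc, ← mul_assoc, hy₃, hgf, hy₄]
  have hge' : g' = e' * ((y : R) * f' * ((y⁻¹ : Rˣ) : R)) := by
    rw [heyf] at hle ⊢
    have := G.conj_eq_conj_of_mul_eq hg (a := 1) (b := v₁⁻¹ * v) (by simpa using hle)
    simpa using this
  rw [← mul_assoc, ← mul_assoc, eq_comm, Units.mul_inv_eq_iff_eq_mul, hy₃] at hge'
  calc e' * (w : R) * f' = e' * (v₁ : R) * (y : R) * ((x : R) * f') := by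
        rw [← hprod]; simp [mul_assoc]
    _ = (v₁ : R) * (e' * (y : R) * f') * (x : R) := by rw [hx₂, ← hv₂]; simp [mul_assoc]
    _ = (v₁ : R) * g' * (x : R) := by rw [hge']

theorem exists_mul_mul_eq {e f : R} (he : e ∈ G.Λ) (hf : f ∈ G.Λ) (w : Rˣ) :
    ∃ g ∈ G.Λ, ∃ v ∈ G.parab (G.lam e), ∃ y ∈ G.parab (G.lamStar g), ∃ x : Rˣ,
      (∀ u ∈ G.parab (G.lam g), G.cs.length x ≤ G.cs.length (u * x)) ∧
        w = v * y * x ∧ G.cs.length w = G.cs.length v + G.cs.length y + G.cs.length x ∧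
        e * (w : R) * f = (v : R) * g * (x : R) := by
  obtain ⟨g, hg, hge, hgf, v, hv, y, hy, x, hx, rfl, hlen, heq⟩ :=
    G.exists_mul_mul_eq_of_mem he hf w
  obtain ⟨z, hz, x', rfl, hx'⟩ := G.cs.exists_forall_length_le_mul_left (G.parab (G.lam g)) x
  have hzx := G.cs.length_mul_of_forall_length_le _ hx' hz
  obtain ⟨c, hc, d, hd, rfl, hcl⟩ := G.exists_mul_of_mem_parab_lam_of_forall_length hg hz
  have hce : c ∈ G.parab (G.lam e) := G.parab_lamCostar_le hg he hge hc
  have hcg := (G.mem_parab_lam hg _).mp (G.parab_lamCostar_le hg hg (G.lam_idem g hg) hc)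
  have hcg' := (G.mem_parab_lam hg _).mp
    (inv_mem (G.parab_lamCostar_le hg hg (G.lam_idem g hg) hc))
  have hd' := (G.mul_eq_self_iff (G.lam_idem g hg) d).mp ((G.mem_parab_lamStar hg _).mp hd)
  have hyc : c⁻¹ * y * c ∈ G.parab (G.lamStar g) := by
    rw [G.mem_parab_lamStar hg] at hy ⊢
    push_cast
    rw [mul_assoc, hcg, mul_assoc, ← mul_assoc (y : R), hy, ← mul_assoc, hcg', mul_assoc,
      Units.inv_mul, mul_one]
  have hycl := hcl _ hyc
  rw [show c * (c⁻¹ * y * c) = y * c by group] at hycl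
  have hyle := G.cs.length_mul_le y c
  have hw : v * y * (c * d * x') = v * c * (c⁻¹ * y * c * d) * x' := by group
  refine ⟨g, hg, v * c, mul_mem hv hce, c⁻¹ * y * c * d, mul_mem hyc hd, x', hx', hw, ?_, ?_⟩
  · have h₁ := G.cs.length_mul_le v c
    have h₂ := G.cs.length_mul_le (c⁻¹ * y * c) d
    have h₃ := G.cs.length_mul_le (v * c * (c⁻¹ * y * c * d)) x'
    have h₄ := G.cs.length_mul_le (v * c) (c⁻¹ * y * c * d)
    have h₅ := hcl _ hd
    rw [← hw] at h₃
    lia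
  · rw [heq]
    push_cast
    rw [← mul_assoc, ← mul_assoc, mul_assoc (v : R) g, ← hcg, ← mul_assoc, mul_assoc _ g, hd']

end GRCSystem

namespace GRCSystem

theorem wordLen_append {B R : Type*} (l l' : List (B ⊕ R)) :
    wordLen (l ++ l') = wordLen l + wordLen l' := by
  simp [wordLen]

theorem wordLen_inl_cons {B R : Type*} (s : B) (l : List (B ⊕ R)) :
    wordLen (Sum.inl s :: l) = wordLen l + 1 := by
  simp [wordLen, List.filter_cons]

theorem wordLen_inr_cons {B R : Type*} (e : R) (l : List (B ⊕ R)) :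
    wordLen (Sum.inr e :: l) = wordLen l := by
  simp [wordLen]

variable {B R : Type*} [Monoid R] (G : GRCSystem B R)

theorem parab_lamStar_le {e : R} (he : e ∈ G.Λ) : G.parab (G.lamStar e) ≤ G.parab (G.lam e) := by
  intro u hu
  rw [G.mem_parab_lamStar he] at hu
  rw [G.mem_parab_lam he, hu, (G.mul_eq_self_iff (G.lam_idem e he) u).mp hu]

theorem exists_isNormalDecomp_mul_mul {e : R} (he : e ∈ G.Λ) (w₁ w₂ : Rˣ) :
    ∃ w₁' w₂' : Rˣ, G.IsNormalDecomp ((w₁ : R) * e * (w₂ : R)) w₁' e w₂' ∧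
      G.cs.length w₁' + G.cs.length w₂' ≤ G.cs.length w₁ + G.cs.length w₂ := by
  obtain ⟨z, hz, w₂', rfl, h₂⟩ := G.cs.exists_forall_length_le_mul_left (G.parab (G.lam e)) w₂
  obtain ⟨d, hd, w₁', h, h₁⟩ :=
    G.cs.exists_forall_length_le_mul_right (G.parab (G.lamStar e)) (w₁ * z)
  have hl₂ := G.cs.length_mul_of_forall_length_le _ h₂ hz
  have hl₁ := h₁ d hd
  rw [← h] at hl₁
  have hl := G.cs.length_mul_le w₁ z
  refine ⟨w₁', w₂', ⟨he, h₁, h₂, ?_⟩, by lia⟩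
  rw [G.mem_parab_lam he] at hz
  rw [G.mem_parab_lamStar he] at hd
  calc (w₁ : R) * e * ((z * w₂' : Rˣ) : R) = (w₁ : R) * (e * (z : R)) * (w₂' : R) := by
        simp [mul_assoc]
    _ = ((w₁ * z : Rˣ) : R) * e * (w₂' : R) := by rw [← hz]; simp [mul_assoc]
    _ = (w₁' : R) * e * (w₂' : R) := by rw [h, Units.val_mul, mul_assoc (w₁' : R), hd]

theorem exists_isNormalDecomp (r : R) : ∃ w₁ e w₂, G.IsNormalDecomp r w₁ e w₂ := by
  obtain ⟨p, g, hp, rfl⟩ := G.factor r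
  obtain ⟨e, ⟨he, w, rfl⟩, -⟩ := G.transversal p hp
  obtain ⟨w₁, w₂, h, -⟩ := G.exists_isNormalDecomp_mul_mul he w (w⁻¹ * g)
  exact ⟨w₁, e, w₂, by simpa [mul_assoc] using h⟩

theorem eq_of_mul_eq_mul {e f : R} (he : e ∈ G.Λ) (hf : f ∈ G.Λ) {a b : Rˣ}
    (h : (a : R) * e = f * (b : R)) :
    f = e ∧ a ∈ G.parab (G.lam e) ∧ b⁻¹ * a ∈ G.parab (G.lamStar e) := by
  have hei := G.lam_idem e he
  have hfi := G.lam_idem f hf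
  set p : R := (a : R) * e * ((a⁻¹ : Rˣ) : R) with hp
  have hpi : IsIdempotentElem p := isIdempotentElem_conj hei a
  have h₁ : f * p = p := by rw [hp, h, ← mul_assoc, ← mul_assoc, hfi.eq]
  have h₂ : p * f = f := by
    have hfb : f = (a : R) * e * ((b⁻¹ : Rˣ) : R) := by rw [Units.eq_mul_inv_iff_mul_eq, h]
    have hpe : p * ((a : R) * e * ((b⁻¹ : Rˣ) : R)) = (a : R) * e * ((b⁻¹ : Rˣ) : R) := by
      rw [hp]
      simp only [mul_assoc, Units.inv_mul_cancel_left]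
      rw [← mul_assoc e e, hei.eq]
    rwa [← hfb] at hpe
  have hfp : f = p := h₂.symm.trans ((G.idem_mul_comm p f hpi hfi).trans h₁)
  have hfe : f = e := G.eq_of_conj_eq (a := 1) (b := a) hf he (by simpa using hfp)
  subst hfe
  have ha : (a : R) * f = f * (a : R) := (Units.mul_inv_eq_iff_eq_mul a).mp hfp.symm
  refine ⟨rfl, (G.mem_parab_lam he a).mpr ha, (G.mem_parab_lamStar he _).mpr ?_⟩
  rw [G.mul_eq_self_iff hei, Units.val_mul, ← mul_assoc]
  have : f * ((b⁻¹ : Rˣ) : R) = ((a⁻¹ : Rˣ) : R) * f := by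
    rw [Units.mul_inv_eq_iff_eq_mul, mul_assoc, ← h, Units.inv_mul_cancel_left]
  rw [this, mul_assoc, ← ha, Units.inv_mul_cancel_left]

theorem length_add_length_le {r : R} {w₁ w₂ : Rˣ} {e : R} (h : G.IsNormalDecomp r w₁ e w₂)
    {v₁ v₂ : Rˣ} {f : R} (hf : f ∈ G.Λ) (hr : r = (v₁ : R) * f * (v₂ : R)) :
    G.cs.length w₁ + G.cs.length w₂ ≤ G.cs.length v₁ + G.cs.length v₂ := by
  obtain ⟨he, h₁, h₂, h₃⟩ := h
  have key : ((v₁⁻¹ * w₁ : Rˣ) : R) * e = f * ((v₂ * w₂⁻¹ : Rˣ) : R) := by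
    rw [h₃, ← Units.eq_mul_inv_iff_mul_eq, mul_assoc, mul_assoc,
      ← Units.inv_mul_eq_iff_eq_mul] at hr
    simpa [mul_assoc] using hr
  obtain ⟨-, ha, hba⟩ := G.eq_of_mul_eq_mul he hf key
  set b := v₂ * w₂⁻¹ with hb
  have hbm : b ∈ G.parab (G.lam e) := by
    have := mul_mem ha (inv_mem (G.parab_lamStar_le he hba))
    rwa [show v₁⁻¹ * w₁ * (b⁻¹ * (v₁⁻¹ * w₁))⁻¹ = b by group] at this
  have hl₂ := G.cs.length_mul_of_forall_length_le _ h₂ hbm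
  rw [hb, inv_mul_cancel_right, ← hb] at hl₂
  have hl₁ := h₁ _ (inv_mem hba)
  have hl := G.cs.length_mul_le v₁ b
  rw [show w₁ * (b⁻¹ * (v₁⁻¹ * w₁))⁻¹ = v₁ * b by group] at hl₁
  lia

theorem exists_eq_mul_mul_of_isWord {l : List (B ⊕ R)} (hl : G.IsWord l) :
    ∃ w₁ w₂ : Rˣ, ∃ e ∈ G.Λ, (l.map G.letterVal).prod = (w₁ : R) * e * (w₂ : R) ∧
      G.cs.length w₁ + G.cs.length w₂ ≤ wordLen l := by
  induction l with
  | nil => exact ⟨1, 1, 1, G.one_mem_Λ, by simp [wordLen]⟩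
  | cons a l ih =>
    obtain ⟨w₁, w₂, e, he, hr, hlen⟩ := ih fun e he => hl e (List.mem_cons_of_mem _ he)
    rw [List.map_cons, List.prod_cons, hr]
    cases a with
    | inl s =>
      refine ⟨G.cs.simple s * w₁, w₂, e, he, by simp [letterVal, mul_assoc], ?_⟩
      have h := G.cs.length_mul_le (G.cs.simple s) w₁
      rw [CoxeterSystem.length_simple] at h
      rw [wordLen_inl_cons]
      lia
    | inr f =>
      obtain ⟨g, hg, v, -, y, -, x, -, -, hl', hx⟩ :=
        G.exists_mul_mul_eq (hl f List.mem_cons_self).1 he w₁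
      refine ⟨v, x * w₂, g, hg, ?_, ?_⟩
      · rw [← mul_assoc, ← mul_assoc, letterVal, Sum.elim_inr, id, hx]; simp [mul_assoc]
      · have h := G.cs.length_mul_le x w₂
        rw [wordLen_inr_cons]
        lia

theorem exists_isWord_eq_unit (w : Rˣ) :
    ∃ l : List (B ⊕ R), G.IsWord l ∧ (l.map G.letterVal).prod = (w : R) ∧
      wordLen l = G.cs.length w := by
  obtain ⟨ω, hω, rfl⟩ := G.cs.exists_isReduced w
  refine ⟨ω.map Sum.inl, by simp [IsWord], ?_, ?_⟩
  · rw [List.map_map]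
    have := map_list_prod (Units.coeHom R) (ω.map G.cs.simple)
    rw [List.map_map] at this
    exact this.symm
  · rw [← hω.eq.symm]
    simp [wordLen, List.filter_eq_self.mpr]

theorem len_le_of_isWord {l : List (B ⊕ R)} (hl : G.IsWord l) :
    G.len (l.map G.letterVal).prod ≤ wordLen l :=
  Nat.sInf_le ⟨l, hl, rfl, rfl⟩

theorem isWord_append {l l' : List (B ⊕ R)} (h : G.IsWord l) (h' : G.IsWord l') :
    G.IsWord (l ++ l') := fun e he => (List.mem_append.mp he).elim (h e) (h' e)

theorem exists_isWord_eq_mul_mul {e : R} (he : e ∈ G.Λ) (w₁ w₂ : Rˣ) :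
    ∃ l : List (B ⊕ R), G.IsWord l ∧ (l.map G.letterVal).prod = (w₁ : R) * e * (w₂ : R) ∧
      wordLen l = G.cs.length w₁ + G.cs.length w₂ := by
  obtain ⟨l₁, h₁, hp₁, hl₁⟩ := G.exists_isWord_eq_unit w₁
  obtain ⟨l₂, h₂, hp₂, hl₂⟩ := G.exists_isWord_eq_unit w₂
  by_cases h : e = 1
  · exact ⟨l₁ ++ l₂, G.isWord_append h₁ h₂, by simp [hp₁, hp₂, h],
      by rw [wordLen_append, hl₁, hl₂]⟩
  · refine ⟨l₁ ++ (Sum.inr e :: l₂), G.isWord_append h₁ fun f hf => ?_,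
      ?_, ?_⟩
    · rcases List.mem_cons.mp hf with hf | hf
      · obtain rfl := Sum.inr_injective hf
        exact ⟨he, h⟩
      · exact h₂ f hf
    · rw [List.map_append, List.prod_append, List.map_cons, List.prod_cons, hp₁, hp₂, ← mul_assoc]
      rfl
    · rw [wordLen_append, wordLen_inr_cons, hl₁, hl₂]

theorem len_mul_mul_le {e : R} (he : e ∈ G.Λ) (w₁ w₂ : Rˣ) :
    G.len ((w₁ : R) * e * (w₂ : R)) ≤ G.cs.length w₁ + G.cs.length w₂ := by
  obtain ⟨l, hl, hp, hlen⟩ := G.exists_isWord_eq_mul_mul he w₁ w₂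
  rw [← hp, ← hlen]
  exact G.len_le_of_isWord hl

theorem exists_isWord_len_eq (r : R) :
    ∃ l : List (B ⊕ R), G.IsWord l ∧ (l.map G.letterVal).prod = r ∧ G.len r = wordLen l := by
  obtain ⟨w₁, e, w₂, h⟩ := G.exists_isNormalDecomp r
  obtain ⟨l, hl, hp, -⟩ := G.exists_isWord_eq_mul_mul h.1 w₁ w₂
  rw [← h.2.2.2] at hp
  exact Nat.sInf_mem (s := {n : ℕ | ∃ l : List (B ⊕ R), G.IsWord l ∧
    (l.map G.letterVal).prod = r ∧ n = wordLen l}) ⟨_, l, hl, hp, rfl⟩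

variable {G} in
theorem IsNormalDecomp.len_eq {r : R} {w₁ w₂ : Rˣ} {e : R} (h : G.IsNormalDecomp r w₁ e w₂) :
    G.len r = G.cs.length w₁ + G.cs.length w₂ := by
  refine le_antisymm (h.2.2.2 ▸ G.len_mul_mul_le h.1 w₁ w₂) ?_
  obtain ⟨l, hl, hp, hlen⟩ := G.exists_isWord_len_eq r
  obtain ⟨v₁, v₂, f, hf, hr, hle⟩ := G.exists_eq_mul_mul_of_isWord hl
  have := G.length_add_length_le h hf (hp ▸ hr)
  lia

theorem len_unit (w : Rˣ) : G.len (w : R) ≤ G.cs.length w := by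
  simpa using G.len_mul_mul_le G.one_mem_Λ w 1

theorem len_one : G.len (1 : R) = 0 := by
  simpa using G.len_unit 1

theorem len_simple_mul_le (s : B) (r : R) : G.len ((G.cs.simple s : R) * r) ≤ G.len r + 1 := by
  obtain ⟨l, hl, rfl, hlen⟩ := G.exists_isWord_len_eq r
  refine (G.len_le_of_isWord (l := Sum.inl s :: l) fun e he => hl e (by simpa using he)).trans ?_
  rw [hlen, wordLen_inl_cons]

theorem len_mul_le_of_mem {e : R} (he : e ∈ G.Λ) (r : R) : G.len (e * r) ≤ G.len r := by
  rcases eq_or_ne e 1 with rfl | h1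
  · rw [one_mul]
  obtain ⟨l, hl, rfl, hlen⟩ := G.exists_isWord_len_eq r
  refine (G.len_le_of_isWord (l := Sum.inr e :: l) fun f hf => ?_).trans ?_
  · rcases List.mem_cons.mp hf with hf | hf
    · obtain rfl := Sum.inr_injective hf
      exact ⟨he, h1⟩
    · exact hl f hf
  · rw [hlen, wordLen_inr_cons]

theorem len_of_mem {e : R} (he : e ∈ G.Λ) : G.len e = 0 := by
  simpa [G.len_one] using G.len_mul_le_of_mem he 1

theorem simple_mul_simple_mul (s : B) (r : R) :
    (G.cs.simple s : R) * ((G.cs.simple s : R) * r) = r := by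
  rw [← mul_assoc, ← Units.val_mul, CoxeterSystem.simple_mul_simple_self, Units.val_one, one_mul]

variable {G} in
theorem IsNormalDecomp.simple_mul {r : R} {w₁ w₂ : Rˣ} {e : R} (h : G.IsNormalDecomp r w₁ e w₂)
    (s : B) :
    ((G.cs.simple s : R) * r = r ∧
      ∃ u ∈ G.parab (G.lamStar e), G.cs.simple s * w₁ = w₁ * u) ∨
    (G.IsNormalDecomp ((G.cs.simple s : R) * r) (G.cs.simple s * w₁) e w₂ ∧
      ∀ u ∈ G.parab (G.lamStar e),
        (G.cs.IsLeftDescent (w₁ * u) s ↔ G.cs.IsLeftDescent w₁ s)) := by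
  obtain ⟨he, h₁, h₂, rfl⟩ := h
  refine (G.cs.exists_mul_or_forall_length_le_mul_simple_left _ s h₁).imp (fun h => ⟨?_, h⟩)
    fun h => ⟨⟨he, h.2, h₂, by simp [mul_assoc]⟩, h.1⟩
  obtain ⟨u, hu, h⟩ := h
  rw [← mul_assoc, ← mul_assoc, ← Units.val_mul, h, Units.val_mul, mul_assoc (w₁ : R),
    (G.mem_parab_lamStar he u).mp hu]

theorem len_simple_mul (s : B) (r : R) :
    G.len ((G.cs.simple s : R) * r) = G.len r + 1 ∨ (G.cs.simple s : R) * r = r ∨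
      G.len ((G.cs.simple s : R) * r) + 1 = G.len r := by
  obtain ⟨w₁, e, w₂, h⟩ := G.exists_isNormalDecomp r
  rcases h.simple_mul s with ⟨h', -⟩ | ⟨h', -⟩
  · exact Or.inr (Or.inl h')
  · rw [h.len_eq, h'.len_eq]
    have := G.cs.length_simple_mul w₁ s
    lia

theorem simple_mul_eq_of_len_eq {s : B} {r : R}
    (h : G.len ((G.cs.simple s : R) * r) = G.len r) : (G.cs.simple s : R) * r = r := by
  rcases G.len_simple_mul s r with h' | h' | h'
  · lia
  · exact h'
  · lia

theorem len_mul_le_len_simple_mul_mul {s : B} {r e : R} (he : e ∈ G.Λ)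
    (h : G.len ((G.cs.simple s : R) * r) = G.len r + 1) :
    G.len (r * e) ≤ G.len ((G.cs.simple s : R) * (r * e)) := by
  obtain ⟨w₁, f, w₂, hn⟩ := G.exists_isNormalDecomp r
  obtain ⟨hf, h₁, h₂, hr⟩ := id hn
  obtain ⟨g, hg, v, hv, y, hy, x, hx, hw, hl, heq⟩ := G.exists_mul_mul_eq hf he w₂
  obtain rfl : v = 1 := by
    have hle := h₂ _ (inv_mem hv)
    rw [hw, mul_assoc v, inv_mul_cancel_left, ← mul_assoc, ← hw] at hle
    have := G.cs.length_mul_le y x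
    exact G.cs.length_eq_zero_iff.mp (by lia)
  obtain ⟨d, hd, w₁', hw₁, hm⟩ := G.cs.exists_forall_length_le_mul_right (G.parab (G.lamStar g)) w₁
  have hre : r * e = (w₁' : R) * g * (x : R) := by
    rw [hr, mul_assoc, mul_assoc, ← mul_assoc f, heq, Units.val_one, one_mul, hw₁, Units.val_mul,
      ← mul_assoc, mul_assoc (w₁' : R), (G.mem_parab_lamStar hg d).mp hd]
  have hn' : G.IsNormalDecomp (r * e) w₁' g x := ⟨hg, hm, hx, hre⟩
  have hnd : ¬ G.cs.IsLeftDescent w₁ s := by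
    rw [CoxeterSystem.not_isLeftDescent_iff]
    have := G.len_mul_mul_le hf (G.cs.simple s * w₁) w₂
    rw [Units.val_mul, mul_assoc, mul_assoc, ← mul_assoc (w₁ : R), ← hr, h, hn.len_eq] at this
    have h' := G.cs.length_simple_mul w₁ s
    lia
  rcases hn'.simple_mul s with ⟨h', -⟩ | ⟨h', hd'⟩
  · rw [h']
  · have := (hd' d hd).not
    rw [← hw₁] at this
    have := G.cs.not_isLeftDescent_iff.mp (this.mp hnd)
    rw [hn'.len_eq, h'.len_eq]
    lia

theorem simple_mul_eq_mul_simple {s t : B} {r : R}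
    (hs : G.len ((G.cs.simple s : R) * r) = G.len r + 1)
    (ht : G.len (r * (G.cs.simple t : R)) = G.len r + 1)
    (hst : G.len ((G.cs.simple s : R) * (r * (G.cs.simple t : R))) = G.len r) :
    (G.cs.simple s : R) * r = r * (G.cs.simple t : R) := by
  obtain ⟨w₁, e, w₂, hn⟩ := G.exists_isNormalDecomp r
  obtain ⟨he, h₁, h₂, hr⟩ := id hn
  have hns : G.IsNormalDecomp ((G.cs.simple s : R) * r) (G.cs.simple s * w₁) e w₂ := by
    rcases hn.simple_mul s with ⟨h', -⟩ | ⟨h', -⟩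
    · rw [h'] at hs; lia
    · exact h'
  have hsl := hns.len_eq
  rw [hs, hn.len_eq] at hsl
  have hnd : ¬ G.cs.IsLeftDescent w₁ s := by
    rw [CoxeterSystem.not_isLeftDescent_iff]; lia
  rcases G.cs.exists_mul_or_forall_length_le_mul_simple_right _ t h₂ with ⟨u, hu, hu'⟩ | h'
  · have hlu := G.cs.length_mul_of_forall_length_le _ h₂ hu
    have hlt := G.cs.length_mul_simple w₂ t
    rw [hu'] at hlt
    have hrt : r * (G.cs.simple t : R) = ((w₁ * u : Rˣ) : R) * e * (w₂ : R) := by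
      rw [hr, mul_assoc, ← Units.val_mul, hu', Units.val_mul, Units.val_mul, ← mul_assoc,
        mul_assoc (w₁ : R) (u : R), (G.mem_parab_lam he u).mp hu, mul_assoc (w₁ : R)]
    obtain ⟨j, rfl⟩ : ∃ j, u = G.cs.simple j := by
      rw [← G.cs.length_eq_one_iff]
      rcases hlt with hlt | hlt
      · lia
      · lia
    obtain ⟨d, hd, w₁', hw₁, hm⟩ := G.cs.exists_forall_length_le_mul_right
      (G.parab (G.lamStar e)) (w₁ * G.cs.simple j)
    have hnt : G.IsNormalDecomp (r * (G.cs.simple t : R)) w₁' e w₂ := by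
      refine ⟨he, hm, h₂, ?_⟩
      rw [hrt, hw₁, Units.val_mul, mul_assoc (w₁' : R), (G.mem_parab_lamStar he d).mp hd]
    have hdesc : G.cs.IsLeftDescent (w₁ * G.cs.simple j) s := by
      rcases hnt.simple_mul s with ⟨h', -⟩ | ⟨h', hd'⟩
      · rw [h'] at hst; lia
      · rw [hw₁, hd' d hd, CoxeterSystem.isLeftDescent_iff]
        have := h'.len_eq
        rw [hst] at this
        have := hnt.len_eq
        lia
    have hex := G.cs.simple_mul_eq_mul_simple_of_isLeftDescent hnd hdesc
    rw [hrt, ← hex, hr, Units.val_mul]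
    simp only [mul_assoc]
  · have hnt : G.IsNormalDecomp (r * (G.cs.simple t : R)) w₁ e (w₂ * G.cs.simple t) :=
      ⟨he, h₁, h', by rw [hr, Units.val_mul, mul_assoc]⟩
    rcases hnt.simple_mul s with ⟨h', -⟩ | ⟨h', -⟩
    · rw [h'] at hst; lia
    · have h1 := h'.len_eq
      have h2 := hnt.len_eq
      have h3 := hn.len_eq
      lia

end GRCSystem

namespace GRCSystem

section Star

variable {B R : Type*} [Monoid R] (G : GRCSystem B R)

theorem exists_weakInverse (G : GRCSystem B R) (r : R) : ∃ x, r * x * r = r ∧ x * r * x = x := by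
  obtain ⟨e, g, he, rfl⟩ := G.factor r
  refine ⟨((g⁻¹ : Rˣ) : R) * e, ?_, ?_⟩
  · simp only [mul_assoc, Units.mul_inv_cancel_left]
    rw [← mul_assoc e e, he.eq, ← mul_assoc e e, he.eq]
  · simp only [mul_assoc, Units.mul_inv_cancel_left]
    rw [he.eq, he.eq]

/-- The inverse of `r` in the inverse monoid `R`. -/
def star (r : R) : R := (G.exists_weakInverse r).choose

theorem mul_star_mul (r : R) : r * G.star r * r = r := (G.exists_weakInverse r).choose_spec.1

theorem star_mul_star (r : R) : G.star r * r * G.star r = G.star r :=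
  (G.exists_weakInverse r).choose_spec.2

theorem isIdempotentElem_mul_of_mul_mul_eq {r x : R} (h : r * x * r = r) :
    IsIdempotentElem (r * x) ∧ IsIdempotentElem (x * r) :=
  ⟨by rw [IsIdempotentElem, ← mul_assoc, h], by rw [IsIdempotentElem, mul_assoc, ← mul_assoc r, h]⟩

theorem star_eq {r x : R} (h₁ : r * x * r = r) (h₂ : x * r * x = x) : G.star r = x := by
  have key : ∀ {y z : R}, r * y * r = r → r * z * r = r → y * r * y = y → y = y * r * z := by
    intro y z hy hz hy'
    calc y = y * ((r * z) * (r * y)) := by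
          rw [← mul_assoc (r * z), hz, ← mul_assoc, hy']
      _ = y * ((r * y) * (r * z)) := by
          rw [G.idem_mul_comm _ _ (isIdempotentElem_mul_of_mul_mul_eq hz).1
            (isIdempotentElem_mul_of_mul_mul_eq hy).1]
      _ = y * r * z := by rw [← mul_assoc (r * y), hy, mul_assoc]
  have key' : ∀ {y z : R}, r * y * r = r → r * z * r = r → y * r * y = y → y = z * r * y := by
    intro y z hy hz hy'
    calc y = ((y * r) * (z * r)) * y := by
          rw [mul_assoc y, ← mul_assoc r, hz, hy']
      _ = ((z * r) * (y * r)) * y := by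
          rw [G.idem_mul_comm _ _ (isIdempotentElem_mul_of_mul_mul_eq hz).2
            (isIdempotentElem_mul_of_mul_mul_eq hy).2]
      _ = z * r * y := by rw [mul_assoc z, ← mul_assoc r, hy]
  exact (key' (G.mul_star_mul r) h₁ (G.star_mul_star r)).trans
    (key h₁ (G.mul_star_mul r) h₂).symm

theorem star_star (r : R) : G.star (G.star r) = r :=
  G.star_eq (G.star_mul_star r) (G.mul_star_mul r)

theorem star_mul (a b : R) : G.star (a * b) = G.star b * G.star a := by
  have hc := G.idem_mul_comm _ _ (isIdempotentElem_mul_of_mul_mul_eq (G.mul_star_mul b)).1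
    (isIdempotentElem_mul_of_mul_mul_eq (G.mul_star_mul a)).2
  refine G.star_eq ?_ ?_
  · calc a * b * (G.star b * G.star a) * (a * b)
        = a * ((b * G.star b) * (G.star a * a)) * b := by simp only [mul_assoc]
      _ = (a * G.star a * a) * (b * G.star b * b) := by rw [hc]; simp only [mul_assoc]
      _ = a * b := by rw [mul_star_mul, mul_star_mul]
  · calc G.star b * G.star a * (a * b) * (G.star b * G.star a)
        = G.star b * ((G.star a * a) * (b * G.star b)) * G.star a := by simp only [mul_assoc]
      _ = (G.star b * b * G.star b) * (G.star a * a * G.star a) := by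
          rw [← hc]; simp only [mul_assoc]
      _ = G.star b * G.star a := by rw [star_mul_star, star_mul_star]

theorem star_of_isIdempotentElem {e : R} (he : IsIdempotentElem e) : G.star e = e :=
  G.star_eq (by rw [he.eq, he.eq]) (by rw [he.eq, he.eq])

theorem star_unit (w : Rˣ) : G.star (w : R) = ((w⁻¹ : Rˣ) : R) :=
  G.star_eq (by simp) (by simp)

theorem star_simple (s : B) : G.star (G.cs.simple s : R) = (G.cs.simple s : R) := by
  rw [star_unit, CoxeterSystem.inv_simple]

theorem len_star (r : R) : G.len (G.star r) = G.len r := by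
  have key : ∀ r, G.len (G.star r) ≤ G.len r := by
    intro r
    obtain ⟨w₁, e, w₂, h⟩ := G.exists_isNormalDecomp r
    have := G.len_mul_mul_le h.1 w₂⁻¹ w₁⁻¹
    rw [CoxeterSystem.length_inv, CoxeterSystem.length_inv, add_comm, ← h.len_eq] at this
    convert this using 2
    rw [h.2.2.2, star_mul, star_mul, star_unit, star_unit,
      G.star_of_isIdempotentElem (G.lam_idem e h.1), mul_assoc]
  exact le_antisymm (key r) (by simpa only [star_star] using key (G.star r))

theorem star_simple_mul (s : B) (r : R) :
    G.star ((G.cs.simple s : R) * r) = G.star r * (G.cs.simple s : R) := by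
  rw [star_mul, star_simple]

theorem star_mul_simple (s : B) (r : R) :
    G.star (r * (G.cs.simple s : R)) = (G.cs.simple s : R) * G.star r := by
  rw [star_mul, star_simple]

theorem star_mul_of_mem {e : R} (he : e ∈ G.Λ) (r : R) : G.star (e * r) = G.star r * e := by
  rw [star_mul, G.star_of_isIdempotentElem (G.lam_idem e he)]

theorem star_mul_of_mem_right {e : R} (he : e ∈ G.Λ) (r : R) :
    G.star (r * e) = e * G.star r := by
  rw [star_mul, G.star_of_isIdempotentElem (G.lam_idem e he)]

theorem len_mul_simple (r : R) (t : B) :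
    G.len (r * (G.cs.simple t : R)) = G.len r + 1 ∨ r * (G.cs.simple t : R) = r ∨
      G.len (r * (G.cs.simple t : R)) + 1 = G.len r := by
  rw [← G.len_star r, ← G.len_star (r * _), star_mul_simple]
  refine (G.len_simple_mul t (G.star r)).imp_right (Or.imp_left fun h => ?_)
  rw [← G.star_star (r * _), star_mul_simple, h, star_star]

theorem mul_simple_eq_of_len_eq {t : B} {r : R}
    (h : G.len (r * (G.cs.simple t : R)) = G.len r) : r * (G.cs.simple t : R) = r := by
  rcases G.len_mul_simple r t with h' | h' | h'
  · lia
  · exact h'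
  · lia

theorem len_mul_le_of_mem_right {e : R} (he : e ∈ G.Λ) (r : R) : G.len (r * e) ≤ G.len r := by
  rw [← G.len_star r, ← G.len_star (r * _), G.star_mul_of_mem_right he]
  exact G.len_mul_le_of_mem he _

theorem induction_len {P : R → Prop} (one : P 1)
    (simple : ∀ s r, G.len ((G.cs.simple s : R) * r) = G.len r + 1 → P r →
      P ((G.cs.simple s : R) * r))
    (idem : ∀ e ∈ G.Λ, e ≠ 1 → ∀ r, G.len (e * r) = G.len r → P r → P (e * r)) (r : R) : P r := by
  have key : ∀ l : List (B ⊕ R), G.IsWord l → G.len (l.map G.letterVal).prod = wordLen l →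
      P (l.map G.letterVal).prod := by
    intro l hl hlen
    induction l with
    | nil => exact one
    | cons a l ih =>
      have hl' : G.IsWord l := fun e he => hl e (List.mem_cons_of_mem _ he)
      have hle := G.len_le_of_isWord hl'
      rw [List.map_cons, List.prod_cons] at hlen ⊢
      cases a with
      | inl s =>
        have h := G.len_simple_mul_le s (l.map G.letterVal).prod
        change G.len ((G.cs.simple s : R) * _) = _ at hlen
        rw [wordLen_inl_cons] at hlen
        exact simple s _ (by lia) (ih hl' (by lia))
      | inr e =>
        obtain ⟨he, h1⟩ := hl e List.mem_cons_self
        have h := G.len_mul_le_of_mem he (l.map G.letterVal).prod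
        change G.len (e * _) = _ at hlen
        rw [wordLen_inr_cons] at hlen
        exact idem e he h1 _ (by lia) (ih hl' (by lia))
  obtain ⟨l, hl, rfl, hlen⟩ := G.exists_isWord_len_eq r
  exact key l hl hlen

end Star

section Operators

variable {B R : Type*} [Monoid R] (G : GRCSystem B R) {A : Type*} [CommRing A] (q : A)

/-- Left multiplication by `T_s` on the free module over `R`, for `s` a simple reflection. -/
def simpleOp (s : B) : Module.End A (R →₀ A) :=
  Finsupp.linearCombination A fun r =>
    if G.len ((G.cs.simple s : R) * r) = G.len r + 1 then
      Finsupp.single ((G.cs.simple s : R) * r) 1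
    else if G.len ((G.cs.simple s : R) * r) = G.len r then q • Finsupp.single r 1
    else (q - 1) • Finsupp.single r 1 + q • Finsupp.single ((G.cs.simple s : R) * r) 1

/-- Left multiplication by `T_e` on the free module over `R`, for `e ∈ Λ`. -/
def idemOp (e : R) : Module.End A (R →₀ A) :=
  Finsupp.linearCombination A fun r =>
    q ^ (G.len r - G.len (e * r)) • Finsupp.single (e * r) 1

/-- The linear extension of `r ↦ r*`. -/
def starOp (A : Type*) [CommRing A] : Module.End A (R →₀ A) := Finsupp.lmapDomain A A G.star

theorem simpleOp_single_of_len_eq_add_one {s : B} {r : R}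
    (h : G.len ((G.cs.simple s : R) * r) = G.len r + 1) :
    G.simpleOp q s (Finsupp.single r 1) = Finsupp.single ((G.cs.simple s : R) * r) 1 := by
  rw [simpleOp, Finsupp.linearCombination_single, one_smul, if_pos h]

theorem simpleOp_single_of_mul_eq {s : B} {r : R} (h : (G.cs.simple s : R) * r = r) :
    G.simpleOp q s (Finsupp.single r 1) = q • Finsupp.single r 1 := by
  rw [simpleOp, Finsupp.linearCombination_single, one_smul, h, if_neg (by lia), if_pos rfl]

theorem simpleOp_single_of_len_add_one_eq {s : B} {r : R}
    (h : G.len ((G.cs.simple s : R) * r) + 1 = G.len r) :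
    G.simpleOp q s (Finsupp.single r 1) =
      (q - 1) • Finsupp.single r 1 + q • Finsupp.single ((G.cs.simple s : R) * r) 1 := by
  rw [simpleOp, Finsupp.linearCombination_single, one_smul, if_neg (by lia), if_neg (by lia)]

theorem idemOp_single (e r : R) : G.idemOp q e (Finsupp.single r 1) =
    q ^ (G.len r - G.len (e * r)) • Finsupp.single (e * r) 1 := by
  rw [idemOp, Finsupp.linearCombination_single, one_smul]

theorem starOp_single (r : R) (a : A) :
    G.starOp A (Finsupp.single r a) = Finsupp.single (G.star r) a := by
  rw [starOp, Finsupp.lmapDomain_apply, Finsupp.mapDomain_single]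

theorem end_ext {R A : Type*} [CommRing A] {P Q : Module.End A (R →₀ A)}
    (h : ∀ r, P (Finsupp.single r 1) = Q (Finsupp.single r 1)) : P = Q :=
  Finsupp.lhom_ext' fun r => LinearMap.ext_ring (h r)

theorem starOp_mul_starOp : G.starOp A * G.starOp A = 1 :=
  end_ext fun r => by
    rw [Module.End.mul_apply, starOp_single, starOp_single, star_star, Module.End.one_apply]

/-- Right multiplication by `T_s` on the free module over `R`. -/
def simpleOpRight (s : B) : Module.End A (R →₀ A) := G.starOp A * G.simpleOp q s * G.starOp A

/-- Right multiplication by `T_e` on the free module over `R`. -/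
def idemOpRight (e : R) : Module.End A (R →₀ A) := G.starOp A * G.idemOp q e * G.starOp A

theorem simpleOpRight_single_of_len_eq_add_one {s : B} {r : R}
    (h : G.len (r * (G.cs.simple s : R)) = G.len r + 1) :
    G.simpleOpRight q s (Finsupp.single r 1) = Finsupp.single (r * (G.cs.simple s : R)) 1 := by
  rw [← G.len_star, ← G.len_star r, star_mul_simple] at h
  rw [simpleOpRight, Module.End.mul_apply, Module.End.mul_apply, starOp_single,
    G.simpleOp_single_of_len_eq_add_one q h, starOp_single, star_simple_mul, star_star]

theorem simpleOpRight_single_of_mul_eq {s : B} {r : R} (h : r * (G.cs.simple s : R) = r) :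
    G.simpleOpRight q s (Finsupp.single r 1) = q • Finsupp.single r 1 := by
  have h' : (G.cs.simple s : R) * G.star r = G.star r := by rw [← star_mul_simple, h]
  rw [simpleOpRight, Module.End.mul_apply, Module.End.mul_apply, starOp_single,
    G.simpleOp_single_of_mul_eq q h', map_smul, starOp_single, star_star]

theorem simpleOpRight_single_of_len_add_one_eq {s : B} {r : R}
    (h : G.len (r * (G.cs.simple s : R)) + 1 = G.len r) :
    G.simpleOpRight q s (Finsupp.single r 1) =
      (q - 1) • Finsupp.single r 1 + q • Finsupp.single (r * (G.cs.simple s : R)) 1 := by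
  rw [← G.len_star, ← G.len_star r, star_mul_simple] at h
  rw [simpleOpRight, Module.End.mul_apply, Module.End.mul_apply, starOp_single,
    G.simpleOp_single_of_len_add_one_eq q h, map_add, map_smul, map_smul, starOp_single,
    starOp_single, star_simple_mul, star_star]

theorem idemOpRight_single {e : R} (he : e ∈ G.Λ) (r : R) :
    G.idemOpRight q e (Finsupp.single r 1) =
      q ^ (G.len r - G.len (r * e)) • Finsupp.single (r * e) 1 := by
  rw [idemOpRight, Module.End.mul_apply, Module.End.mul_apply, starOp_single, idemOp_single,
    map_smul, starOp_single, G.star_mul_of_mem he, star_star, len_star, ← G.len_star (e * _),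
    G.star_mul_of_mem he, star_star]

theorem simpleOp_mul_self (s : B) :
    G.simpleOp q s * G.simpleOp q s = (q - 1) • G.simpleOp q s + q • (1 : Module.End A _) := by
  refine end_ext fun r => ?_
  rw [Module.End.mul_apply, LinearMap.add_apply, LinearMap.smul_apply, LinearMap.smul_apply,
    Module.End.one_apply]
  have hss := G.simple_mul_simple_mul s r
  rcases G.len_simple_mul s r with h | h | h
  · rw [G.simpleOp_single_of_len_eq_add_one q h,
      G.simpleOp_single_of_len_add_one_eq q (by rw [hss, h]), hss]
  · simp only [G.simpleOp_single_of_mul_eq q h, map_smul]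
    module
  · have h' : G.simpleOp q s (Finsupp.single ((G.cs.simple s : R) * r) 1) =
        Finsupp.single r 1 := by
      rw [G.simpleOp_single_of_len_eq_add_one q (by rw [hss, h]), hss]
    have hr := G.simpleOp_single_of_len_add_one_eq q h
    rw [hr, map_add, map_smul, map_smul, h', hr]

theorem simpleOpRight_mul_self (s : B) : G.simpleOpRight q s * G.simpleOpRight q s =
    (q - 1) • G.simpleOpRight q s + q • (1 : Module.End A _) := by
  calc G.simpleOpRight q s * G.simpleOpRight q s
      = G.starOp A * (G.simpleOp q s * (G.starOp A * G.starOp A) * G.simpleOp q s) *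
          G.starOp A := by simp only [simpleOpRight, mul_assoc]
    _ = _ := by
      rw [starOp_mul_starOp, mul_one, simpleOp_mul_self, mul_add, add_mul, mul_smul_comm,
        mul_smul_comm, smul_mul_assoc, smul_mul_assoc, mul_one, starOp_mul_starOp, simpleOpRight]

theorem apply_apply_comm_of_mul_self {V : Type*} [AddCommGroup V] [Module A V]
    {L P : Module.End A V} (hL : L * L = (q - 1) • L + q • (1 : Module.End A V)) {v : V}
    (h : L (P v) = P (L v)) : L (P (L v)) = P (L (L v)) := by
  have hL' : ∀ x, L (L x) = (q - 1) • L x + q • x := fun x => by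
    rw [← Module.End.mul_apply, hL]; rfl
  rw [← h, hL', hL', map_add, map_smul, map_smul, h]

theorem commute_simpleOp_simpleOpRight (s t : B) :
    Commute (G.simpleOp q s) (G.simpleOpRight q t) := by
  refine end_ext fun r => ?_
  simp only [Module.End.mul_apply]
  induction hn : G.len r using Nat.strong_induction_on generalizing r with
  | _ n ih =>
  subst hn
  have hss := G.simple_mul_simple_mul s r
  have htt : r * (G.cs.simple t : R) * (G.cs.simple t : R) = r := by
    rw [mul_assoc, ← Units.val_mul, CoxeterSystem.simple_mul_simple_self, Units.val_one, mul_one]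
  have hassoc := mul_assoc (G.cs.simple s : R) r (G.cs.simple t : R)
  rcases G.len_simple_mul s r with hs | hs | hs
  rotate_left 2
  · rw [← hss, ← G.simpleOp_single_of_len_eq_add_one q (by rw [hss, hs])]
    exact apply_apply_comm_of_mul_self q (G.simpleOp_mul_self q s) (ih _ (by lia) _ rfl)
  all_goals
    rcases G.len_mul_simple r t with ht | ht | ht
    rotate_left 2
    · rw [← htt, ← G.simpleOpRight_single_of_len_eq_add_one q (by rw [htt, ht])]
      exact (apply_apply_comm_of_mul_self q (G.simpleOpRight_mul_self q t)
        (ih _ (by lia) _ rfl).symm).symm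
  · rw [G.simpleOp_single_of_len_eq_add_one q hs, G.simpleOpRight_single_of_len_eq_add_one q ht]
    rcases G.len_simple_mul s (r * (G.cs.simple t : R)) with h | h | h
    · rw [G.simpleOp_single_of_len_eq_add_one q h,
        G.simpleOpRight_single_of_len_eq_add_one q (by rw [hassoc]; lia), hassoc]
    · have h' := G.mul_simple_eq_of_len_eq (t := t) (r := (G.cs.simple s : R) * r)
        (by rw [hassoc, h]; lia)
      rw [G.simpleOp_single_of_mul_eq q h, G.simpleOpRight_single_of_mul_eq q h', ← h', hassoc, h]
    · have h' := G.simple_mul_eq_mul_simple hs ht (by lia)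
      rw [G.simpleOp_single_of_len_add_one_eq q h,
        G.simpleOpRight_single_of_len_add_one_eq q (by rw [hassoc]; lia), hassoc, h']
  · rw [G.simpleOp_single_of_len_eq_add_one q hs, G.simpleOpRight_single_of_mul_eq q ht, map_smul,
      G.simpleOp_single_of_len_eq_add_one q hs,
      G.simpleOpRight_single_of_mul_eq q (by rw [hassoc, ht])]
  · rw [G.simpleOp_single_of_mul_eq q hs, G.simpleOpRight_single_of_len_eq_add_one q ht, map_smul,
      G.simpleOpRight_single_of_len_eq_add_one q ht,
      G.simpleOp_single_of_mul_eq q (by rw [← hassoc, hs])]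
  · rw [G.simpleOp_single_of_mul_eq q hs, G.simpleOpRight_single_of_mul_eq q ht, map_smul,
      map_smul, G.simpleOp_single_of_mul_eq q hs, G.simpleOpRight_single_of_mul_eq q ht]

theorem commute_simpleOp_idemOpRight (s : B) {e : R} (he : e ∈ G.Λ) :
    Commute (G.simpleOp q s) (G.idemOpRight q e) := by
  refine end_ext fun r => ?_
  simp only [Module.End.mul_apply]
  induction hn : G.len r using Nat.strong_induction_on generalizing r with
  | _ n ih =>
  subst hn
  have hss := G.simple_mul_simple_mul s r
  have hassoc := mul_assoc (G.cs.simple s : R) r e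
  have hle := G.len_mul_le_of_mem_right he r
  rcases G.len_simple_mul s r with hs | hs | hs
  · rw [G.simpleOp_single_of_len_eq_add_one q hs, G.idemOpRight_single q he,
      G.idemOpRight_single q he, map_smul, hs, hassoc]
    have hle' := G.len_mul_le_len_simple_mul_mul he hs
    rcases G.len_simple_mul s (r * e) with h | h | h
    · rw [G.simpleOp_single_of_len_eq_add_one q h, h, Nat.add_sub_add_right]
    · rw [G.simpleOp_single_of_mul_eq q h, h, smul_smul, ← pow_succ, Nat.sub_add_comm hle]
    · lia
  · rw [G.simpleOp_single_of_mul_eq q hs, map_smul, G.idemOpRight_single q he, map_smul,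
      G.simpleOp_single_of_mul_eq q (by rw [← hassoc, hs]), smul_comm]
  · rw [← hss, ← G.simpleOp_single_of_len_eq_add_one q (by rw [hss, hs])]
    exact apply_apply_comm_of_mul_self q (G.simpleOp_mul_self q s) (ih _ (by lia) _ rfl)

theorem commute_idemOp_simpleOpRight (t : B) {e : R} (he : e ∈ G.Λ) :
    Commute (G.idemOp q e) (G.simpleOpRight q t) := by
  have h := (G.commute_simpleOp_idemOpRight q t he).eq
  have hσ : ∀ P : Module.End A (R →₀ A), G.starOp A * (G.starOp A * P) = P := fun P => by
    rw [← mul_assoc, starOp_mul_starOp, one_mul]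
  have := congrArg (fun P => G.starOp A * P * G.starOp A) h
  simp only [idemOpRight, mul_assoc, starOp_mul_starOp, hσ, mul_one] at this
  simp only [Commute, SemiconjBy, simpleOpRight, mul_assoc]
  exact this.symm

theorem commute_idemOp_idemOpRight {e f : R} (he : e ∈ G.Λ) (hf : f ∈ G.Λ) :
    Commute (G.idemOp q e) (G.idemOpRight q f) := by
  refine end_ext fun r => ?_
  have h₁ := G.len_mul_le_of_mem he r
  have h₂ := G.len_mul_le_of_mem_right hf r
  have h₃ := G.len_mul_le_of_mem he (r * f)
  have h₄ := G.len_mul_le_of_mem_right hf (e * r)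
  rw [mul_assoc] at h₄
  rw [Module.End.mul_apply, Module.End.mul_apply, idemOp_single, G.idemOpRight_single q hf,
    map_smul, map_smul, idemOp_single, G.idemOpRight_single q hf, smul_smul, smul_smul, ← pow_add,
    ← pow_add, mul_assoc]
  congr 2
  lia

/-- The operators commuting with all right multiplications by generators. -/
def leftOps : Subalgebra A (Module.End A (R →₀ A)) :=
  Subalgebra.centralizer A (Set.range (G.simpleOpRight q) ∪ G.idemOpRight q '' G.Λ)

theorem simpleOp_mem_leftOps (s : B) : G.simpleOp q s ∈ G.leftOps q := by
  rw [leftOps, Subalgebra.mem_centralizer_iff]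
  rintro _ (⟨t, rfl⟩ | ⟨e, he, rfl⟩)
  · exact (G.commute_simpleOp_simpleOpRight q s t).symm
  · exact (G.commute_simpleOp_idemOpRight q s he).symm

theorem idemOp_mem_leftOps {e : R} (he : e ∈ G.Λ) : G.idemOp q e ∈ G.leftOps q := by
  rw [leftOps, Subalgebra.mem_centralizer_iff]
  rintro _ (⟨t, rfl⟩ | ⟨f, hf, rfl⟩)
  · exact (G.commute_idemOp_simpleOpRight q t he).symm
  · exact (G.commute_idemOp_idemOpRight q he hf).symm

theorem simpleOp_single_one (s : B) :
    G.simpleOp q s (Finsupp.single 1 1) = Finsupp.single (G.cs.simple s : R) 1 := by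
  have h : G.len ((G.cs.simple s : R) * 1) = G.len (1 : R) + 1 := by
    rcases G.len_simple_mul s 1 with h | h | h
    · exact h
    · rw [mul_one, Units.val_eq_one] at h
      have := G.cs.length_simple s
      rw [h, CoxeterSystem.length_one] at this
      lia
    · rw [len_one] at h
      lia
  rw [G.simpleOp_single_of_len_eq_add_one q h, mul_one]

theorem idemOp_single_of_len_eq {e r : R} (h : G.len (e * r) = G.len r) :
    G.idemOp q e (Finsupp.single r 1) = Finsupp.single (e * r) 1 := by
  rw [idemOp_single, h, Nat.sub_self, pow_zero, one_smul]

/-- Evaluation of an operator at `T₁`. -/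
def evalOne : G.leftOps q →ₗ[A] R →₀ A :=
  LinearMap.applyₗ (Finsupp.single 1 1) ∘ₗ (G.leftOps q).val.toLinearMap

theorem evalOne_injective : Function.Injective (G.evalOne q) := by
  intro a b hab
  refine Subtype.ext (end_ext fun r => ?_)
  have comm : ∀ (c : G.leftOps q),
      ∀ P ∈ Set.range (G.simpleOpRight q) ∪ G.idemOpRight q '' G.Λ, ∀ v,
      (c : Module.End A _) (P v) = P ((c : Module.End A _) v) := fun c P hP v => by
    rw [← Module.End.mul_apply, ← Module.End.mul_apply,
      (Subalgebra.mem_centralizer_iff A).mp c.2 P hP]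
  rw [← G.star_star r]
  induction G.star r using G.induction_len with
  | one => rwa [G.star_of_isIdempotentElem IsIdempotentElem.one]
  | simple s r h ih =>
    rw [star_simple_mul, ← G.simpleOpRight_single_of_len_eq_add_one q, comm _ _ (Or.inl ⟨s, rfl⟩),
      comm _ _ (Or.inl ⟨s, rfl⟩), ih]
    rw [← star_simple_mul, len_star, len_star, h]
  | idem e he _ r h ih =>
    have : Finsupp.single (G.star (e * r)) 1 =
        G.idemOpRight q e (Finsupp.single (G.star r) 1) := by
      rw [G.idemOpRight_single q he, ← G.star_mul_of_mem he, len_star, len_star, h, Nat.sub_self,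
        pow_zero, one_smul]
    rw [this, comm _ _ (Or.inr ⟨e, he, rfl⟩), comm _ _ (Or.inr ⟨e, he, rfl⟩), ih]

theorem evalOne_surjective : Function.Surjective (G.evalOne q) := by
  intro x
  induction x using Finsupp.induction_linear with
  | zero => exact ⟨0, map_zero _⟩
  | add x y hx hy =>
    obtain ⟨a, rfl⟩ := hx
    obtain ⟨b, rfl⟩ := hy
    exact ⟨a + b, map_add _ _ _⟩
  | single r c =>
    suffices h : ∃ a, G.evalOne q a = Finsupp.single r 1 by
      obtain ⟨a, ha⟩ := h
      exact ⟨c • a, by rw [map_smul, ha, Finsupp.smul_single_one]⟩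
    induction r using G.induction_len with
    | one => exact ⟨1, rfl⟩
    | simple s r h ih =>
      obtain ⟨a, ha⟩ := ih
      refine ⟨⟨_, G.simpleOp_mem_leftOps q s⟩ * a, ?_⟩
      rw [← G.simpleOp_single_of_len_eq_add_one q h, ← ha]
      rfl
    | idem e he _ r h ih =>
      obtain ⟨a, ha⟩ := ih
      refine ⟨⟨_, G.idemOp_mem_leftOps q he⟩ * a, ?_⟩
      rw [← G.idemOp_single_of_len_eq q h, ← ha]
      rfl

/-- The identification of the free module over `R` with an algebra of operators. -/
def evalOneEquiv : G.leftOps q ≃ₗ[A] R →₀ A :=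
  LinearEquiv.ofBijective (G.evalOne q) ⟨G.evalOne_injective q, G.evalOne_surjective q⟩

/-- The multiplication of the generic Hecke algebra. -/
def heckeMul : (R →₀ A) →ₗ[A] (R →₀ A) →ₗ[A] (R →₀ A) :=
  (G.leftOps q).val.toLinearMap ∘ₗ (G.evalOneEquiv q).symm.toLinearMap

theorem heckeMul_evalOne {P : Module.End A (R →₀ A)} (hP : P ∈ G.leftOps q) :
    G.heckeMul q (P (Finsupp.single 1 1)) = P := by
  have : P (Finsupp.single 1 1) = G.evalOneEquiv q ⟨P, hP⟩ := rfl
  rw [this]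
  simp [heckeMul]

theorem heckeMul_mem (x : R →₀ A) : G.heckeMul q x ∈ G.leftOps q :=
  ((G.evalOneEquiv q).symm x).2

theorem heckeMul_single_one (x : R →₀ A) : G.heckeMul q x (Finsupp.single 1 1) = x :=
  (G.evalOneEquiv q).apply_symm_apply x

theorem one_heckeMul : G.heckeMul q (Finsupp.single 1 1) = 1 :=
  G.heckeMul_evalOne q (one_mem _)

theorem heckeMul_heckeMul (x y : R →₀ A) :
    G.heckeMul q (G.heckeMul q x y) = G.heckeMul q x * G.heckeMul q y := by
  rw [← G.heckeMul_evalOne q (mul_mem (G.heckeMul_mem q x) (G.heckeMul_mem q y)),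
    Module.End.mul_apply, heckeMul_single_one]

theorem heckeMul_simple (s : B) :
    G.heckeMul q (Finsupp.single (G.cs.simple s : R) 1) = G.simpleOp q s := by
  rw [← G.simpleOp_single_one q, G.heckeMul_evalOne q (G.simpleOp_mem_leftOps q s)]

theorem heckeMul_idem {e : R} (he : e ∈ G.Λ) :
    G.heckeMul q (Finsupp.single e 1) = G.idemOp q e := by
  have : G.idemOp q e (Finsupp.single 1 1) = Finsupp.single e 1 := by
    rw [G.idemOp_single_of_len_eq q (by rw [mul_one, G.len_of_mem he, len_one]), mul_one]
  rw [← this, G.heckeMul_evalOne q (G.idemOp_mem_leftOps q he)]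

theorem mul_single_simple_eq {mul : (R →₀ A) →ₗ[A] (R →₀ A) →ₗ[A] (R →₀ A)} {s : B}
    (h : ∀ r : R,
      (G.len ((G.cs.simple s : R) * r) = G.len r + 1 →
        mul (Finsupp.single (G.cs.simple s : R) 1) (Finsupp.single r 1) =
          Finsupp.single ((G.cs.simple s : R) * r) 1) ∧
      (G.len ((G.cs.simple s : R) * r) = G.len r →
        mul (Finsupp.single (G.cs.simple s : R) 1) (Finsupp.single r 1) =
          q • Finsupp.single r 1) ∧
      (G.len ((G.cs.simple s : R) * r) + 1 = G.len r →
        mul (Finsupp.single (G.cs.simple s : R) 1) (Finsupp.single r 1) =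
          (q - 1) • Finsupp.single r 1 + q • Finsupp.single ((G.cs.simple s : R) * r) 1)) :
    mul (Finsupp.single (G.cs.simple s : R) 1) = G.simpleOp q s := by
  refine end_ext fun r => ?_
  rcases G.len_simple_mul s r with hr | hr | hr
  · rw [(h r).1 hr, G.simpleOp_single_of_len_eq_add_one q hr]
  · rw [(h r).2.1 (by rw [hr]), G.simpleOp_single_of_mul_eq q hr]
  · rw [(h r).2.2 hr, G.simpleOp_single_of_len_add_one_eq q hr]

theorem eq_heckeMul {mul : (R →₀ A) →ₗ[A] (R →₀ A) →ₗ[A] (R →₀ A)}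
    (assoc : ∀ x y z, mul (mul x y) z = mul x (mul y z))
    (one_mul' : ∀ x, mul (Finsupp.single 1 1) x = x)
    (simple : ∀ s, mul (Finsupp.single (G.cs.simple s : R) 1) = G.simpleOp q s)
    (idem : ∀ e ∈ G.Λ, e ≠ 1 → mul (Finsupp.single e 1) = G.idemOp q e) :
    mul = G.heckeMul q := by
  refine Finsupp.lhom_ext' fun r => LinearMap.ext_ring ?_
  change mul (Finsupp.single r 1) = G.heckeMul q (Finsupp.single r 1)
  have hmul : ∀ x y, mul (mul x y) = (mul x : Module.End A _) * mul y := fun x y =>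
    LinearMap.ext (assoc x y)
  induction r using G.induction_len with
  | one => rw [one_heckeMul]; exact LinearMap.ext one_mul'
  | simple s r h ih =>
    rw [← G.simpleOp_single_of_len_eq_add_one q h]
    nth_rw 1 [← simple]
    rw [← G.heckeMul_simple q, heckeMul_heckeMul, hmul, ih, simple, heckeMul_simple]
  | idem e he h1 r h ih =>
    rw [← G.idemOp_single_of_len_eq q h]
    nth_rw 1 [← idem e he h1]
    rw [← G.heckeMul_idem q he, heckeMul_heckeMul, hmul, ih, idem e he h1, G.heckeMul_idem q he]

end Operators

end GRCSystem

/-- for any commutative unitary ring `A` and `q ∈ A`, the free `A`-module on a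
generalised Renner monoid `R` carries a unique structure of a unitary associative `A`-algebra
(encoded by its `A`-bilinear multiplication) with unit `T₁` satisfying the Hecke relations. -/
theorem generic_hecke_algebra_exists_unique
    {B R : Type*} [Monoid R] (G : GRCSystem B R)
    (A : Type*) [CommRing A] (q : A) :
    ∃! mul : (R →₀ A) →ₗ[A] (R →₀ A) →ₗ[A] (R →₀ A),
      (∀ x y z : R →₀ A, mul (mul x y) z = mul x (mul y z)) ∧
      (∀ x : R →₀ A, mul (Finsupp.single (1 : R) (1 : A)) x = x) ∧
      (∀ x : R →₀ A, mul x (Finsupp.single (1 : R) (1 : A)) = x) ∧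
      (∀ (s : B) (r : R),
        (G.len ((G.cs.simple s : R) * r) = G.len r + 1 →
          mul (Finsupp.single ((G.cs.simple s : R)) 1) (Finsupp.single r 1)
            = Finsupp.single ((G.cs.simple s : R) * r) 1) ∧
        (G.len ((G.cs.simple s : R) * r) = G.len r →
          mul (Finsupp.single ((G.cs.simple s : R)) 1) (Finsupp.single r 1)
            = q • Finsupp.single r 1) ∧
        (G.len ((G.cs.simple s : R) * r) + 1 = G.len r →
          mul (Finsupp.single ((G.cs.simple s : R)) 1) (Finsupp.single r 1)
            = (q - 1) • Finsupp.single r 1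
              + q • Finsupp.single ((G.cs.simple s : R) * r) 1)) ∧
      (∀ e ∈ G.Λ, e ≠ (1 : R) → ∀ r : R,
        mul (Finsupp.single e 1) (Finsupp.single r 1)
          = q ^ (G.len r - G.len (e * r)) • Finsupp.single (e * r) 1) := by
  refine ⟨G.heckeMul q, ⟨?_, ?_, ?_, ?_, ?_⟩, ?_⟩
  · intro x y z
    rw [G.heckeMul_heckeMul, Module.End.mul_apply]
  · intro x
    rw [G.one_heckeMul, Module.End.one_apply]
  · exact G.heckeMul_single_one q
  · intro s r
    rw [G.heckeMul_simple]
    exact ⟨G.simpleOp_single_of_len_eq_add_one q,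
      fun h => G.simpleOp_single_of_mul_eq q (G.simple_mul_eq_of_len_eq h),
      G.simpleOp_single_of_len_add_one_eq q⟩
  · intro e he _ r
    rw [G.heckeMul_idem q he, G.idemOp_single]
  · rintro mul ⟨assoc, one_mul', -, simple, idem⟩
    refine G.eq_heckeMul q assoc one_mul' (fun s => G.mul_single_simple_eq q (simple s))
      fun e he h1 => GRCSystem.end_ext fun r => ?_
    rw [idem e he h1 r, G.idemOp_single]
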